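/- For all i, j ∈ I and all integers u ≥ 0 and v ≤ 0, the double-expansion coefficients of the inverse (q,t)-deformed Cartan matrix satisfy the anti-periodicity c̃_{ij}(u, v) = −c̃_{i j^*}(u + N, v − h). -/

import Mathlib

noncomputable section

open scoped BigOperators

/-- The field `K = ℚ(q,t)` of rational functions in two variables over `ℚ`. -/
abbrev KK : Type := FractionRing (MvPolynomial (Fin 2) ℚ)

/-- The variable `q` of `ℚ(q,t)`. -/
def qv : KK := algebraMap (MvPolynomial (Fin 2) ℚ) KK (MvPolynomial.X 0)

/-- The variable `t` of `ℚ(q,t)`. -/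
def tv : KK := algebraMap (MvPolynomial (Fin 2) ℚ) KK (MvPolynomial.X 1)

/-- The quantum integer `[k]_q = (q^k - q^{-k})/(q - q⁻¹)` in `ℚ(q,t)`. -/
def qint (k : ℤ) : KK := (qv ^ k - qv ^ (-k)) / (qv - qv⁻¹)

variable {I : Type}

/-- The `(q,t)`-deformed Cartan matrix `C(q,t)`:
`C_{ii} = q^{d_i} t⁻¹ + q^{-d_i} t` and `C_{ij} = [c_{ij}]_q` for `i ≠ j`. -/
def Cqt [DecidableEq I] (c : I → I → ℤ) (d : I → ℤ) (i j : I) : KK :=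
  if i = j then qv ^ (d i) * tv⁻¹ + qv ^ (-(d i)) * tv else qint (c i j)

/-- The basis vector `α_i` of `V = K^{⊕I}`. -/
def alphaK [DecidableEq I] (i : I) : I → KK := Pi.single i 1

/-- The deformed bilinear form `B` on `V`, determined by
`B(α_i, α_j) = [d_i]_q C_{ij}(q,t)`. -/
def Bform [Fintype I] [DecidableEq I] (c : I → I → ℤ) (d : I → ℤ)
    (lam mu : I → KK) : KK :=
  ∑ i, ∑ j, lam i * mu j * (qint (d i) * Cqt c d i j)

/-- The operator `T_i : V → V`, `T_i(λ) = λ - (q^{-d_i} t/[d_i]_q)·B(α_i, λ)·α_i`. -/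
def Trefl [Fintype I] [DecidableEq I] (c : I → I → ℤ) (d : I → ℤ) (i : I)
    (lam : I → KK) : I → KK :=
  fun k => lam k - (qv ^ (-(d i)) * tv / qint (d i)) * Bform c d (alphaK i) lam * alphaK i k

/-- The simple reflection `s_i` on the root lattice `ℤ^{⊕I}`, with `s_i(α_j) = α_j - c_{ij} α_i`. -/
def sZ [Fintype I] [DecidableEq I] (c : I → I → ℤ) (i : I) : (I → ℤ) → (I → ℤ) :=
  fun v k => v k - (if k = i then ∑ j, c i j * v j else 0)

/-- The simple root `α_i` of the root lattice `ℤ^{⊕I}`. -/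
def alphaZ [DecidableEq I] (i : I) : I → ℤ := Pi.single i 1

/-- Membership in the Weyl group `W`, the group of automorphisms of the root lattice
generated by the simple reflections; since each simple reflection is an involution,
`W` is exactly the set of finite products of simple reflections. -/
def memW [Fintype I] [DecidableEq I] (c : I → I → ℤ) (w : (I → ℤ) → (I → ℤ)) : Prop :=
  ∃ l : List I, w = (l.map (sZ c)).foldr (· ∘ ·) id

/-- The field `ℚ((q))` of formal Laurent series. -/
abbrev FF : Type := LaurentSeries ℚ

/-- The field `ℚ((q))((t⁻¹))` of iterated formal Laurent series: the outer variable is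
`s = t⁻¹`, so that Laurent expansion in `t⁻¹` (expansion at `t = ∞`) followed by Laurent
expansion at `q = 0` lands in this field. -/
abbrev LL : Type := LaurentSeries FF

/-- The image of `q` in `ℚ((q))((t⁻¹))`. -/
def qL : LL := HahnSeries.C (HahnSeries.single (1 : ℤ) (1 : ℚ))

/-- The image of `t` in `ℚ((q))((t⁻¹))`: the inverse `s⁻¹` of the outer variable,
i.e. the monomial with outer exponent `-1`. -/
def tL : LL := HahnSeries.single (-1 : ℤ) (1 : FF)

/-- The coefficient of `q^u t^v` of an element of `ℚ((q))((t⁻¹))` (the coefficient of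
`t^v`, i.e. of outer exponent `-v`, is a Laurent series in `q`, of which we take the
coefficient of `q^u`). -/
def dcoeff (x : LL) (u v : ℤ) : ℚ := (x.coeff (-v)).coeff u

set_option linter.unusedSectionVars false

/-- Alternating words. -/
def alt (i j : I) : ℕ → List I
  | 0 => []
  | (k + 1) => i :: alt j i k

lemma alt_length (i j : I) (k : ℕ) : (alt i j k).length = k := by
  induction k generalizing i j with
  | zero => rfl
  | succ k ih => simp [alt, ih]

lemma alt_split (i j : I) (m k : ℕ) :
    ∃ S, alt i j (m + k) = alt i j m ++ S ∧ S.length = k := by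
  induction m generalizing i j with
  | zero => exact ⟨alt i j k, by simp [alt], alt_length _ _ _⟩
  | succ m ih =>
    obtain ⟨S, h1, h2⟩ := ih j i
    refine ⟨S, ?_, h2⟩
    rw [show m + 1 + k = (m + k) + 1 by ring]
    simp [alt, h1]

section Generic

variable {R : Type} [CommRing R] [Fintype I] [DecidableEq I]

/-- The linear form `v ↦ ∑ k, m i k * v k`. -/
def frm (m : I → I → R) (i : I) : (I → R) →ₗ[R] R :=
  ∑ k, m i k • LinearMap.proj k

/-- The basis vector. -/
def bas (i : I) : I → R := Pi.single i 1

/-- The pseudo-reflection `v ↦ v - frm m i v • bas i`. -/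
def rf (m : I → I → R) (i : I) : Module.End R (I → R) :=
  LinearMap.id - (frm m i).smulRight (bas i)

/-- The product of pseudo-reflections along a word. -/
def wd (m : I → I → R) (L : List I) : Module.End R (I → R) := (L.map (rf m)).prod

lemma frm_apply (m : I → I → R) (i : I) (v : I → R) : frm m i v = ∑ k, m i k * v k := by
  simp [frm]

lemma frm_bas (m : I → I → R) (i j : I) : frm m i (bas j) = m i j := by
  simp [frm_apply, bas, Pi.single_apply]

lemma rf_apply (m : I → I → R) (i : I) (v : I → R) : rf m i v = v - frm m i v • bas i := by
  simp [rf]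

lemma rf_bas (m : I → I → R) (i j : I) : rf m i (bas j) = bas j - m i j • bas i := by
  rw [rf_apply, frm_bas]

@[simp] lemma wd_nil (m : I → I → R) : wd m [] = 1 := by simp [wd]

@[simp] lemma wd_cons (m : I → I → R) (i : I) (L : List I) :
    wd m (i :: L) = rf m i * wd m L := by simp [wd]

@[simp] lemma wd_append (m : I → I → R) (L L' : List I) :
    wd m (L ++ L') = wd m L * wd m L' := by simp [wd]

lemma braid2 (m : I → I → R) (i j : I) (h1 : m i j = 0) (h2 : m j i = 0) :
    wd m (alt i j 2) = wd m (alt j i 2) := by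
  ext1 k
  ext1
  simp [alt, rf_apply, frm_bas, h1, h2]
  abel_nf

lemma braid3 (m : I → I → R) (i j : I) (a : R) (h1 : m i i = 1 + a ^ 2) (h2 : m j j = 1 + a ^ 2)
    (h3 : m i j * m j i = a ^ 2) :
    wd m (alt i j 3) = wd m (alt j i 3) := by
  refine LinearMap.ext fun v => funext fun l => ?_
  simp [alt, rf_apply, frm_bas, h1, h2]
  generalize frm m i v = x
  generalize frm m j v = y
  generalize m i j = p at *
  generalize m j i = p' at *
  generalize (bas i : I → R) l = e
  generalize (bas j : I → R) l = e'
  grind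

lemma braid4 (m : I → I → R) (i j : I) (a b : R) (h1 : m i i = 1 + a ^ 2) (h2 : m j j = 1 + b ^ 2)
    (h3 : m i j * m j i = a ^ 2 + b ^ 2) :
    wd m (alt i j 4) = wd m (alt j i 4) := by
  refine LinearMap.ext fun v => funext fun l => ?_
  simp [alt, rf_apply, frm_bas, h1, h2]
  generalize frm m i v = x
  generalize frm m j v = y
  generalize m i j = p at *
  generalize m j i = p' at *
  generalize (bas i : I → R) l = e
  generalize (bas j : I → R) l = e'
  grind

lemma braid6 (m : I → I → R) (i j : I) (a b : R) (h1 : m i i = 1 + a ^ 2) (h2 : m j j = 1 + b ^ 2)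
    (h3 : m i j * m j i = a ^ 2 + a * b + b ^ 2) :
    wd m (alt i j 6) = wd m (alt j i 6) := by
  refine LinearMap.ext fun v => funext fun l => ?_
  simp [alt, rf_apply, frm_bas, h1, h2]
  generalize frm m i v = x
  generalize frm m j v = y
  generalize m i j = p at *
  generalize m j i = p' at *
  generalize (bas i : I → R) l = e
  generalize (bas j : I → R) l = e'
  grind

end Generic

section Words

variable {R : Type} [CommRing R] [Fintype I] [DecidableEq I]

/-- Reduced words. -/
def Red (c : I → I → ℤ) (L : List I) : Prop :=
  ∀ L', wd c L' = wd c L → L.length ≤ L'.length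

/-- No shorter word for `s_i w`. -/
def NoDesc (c : I → I → ℤ) (i : I) (L : List I) : Prop :=
  ∀ L', wd c L' = wd c (i :: L) → L.length ≤ L'.length

/-- The rank two data needed. -/
def BraidOK (c : I → I → ℤ) (M : I → I → R) (i j : I) (m : ℕ) : Prop :=
  1 ≤ m ∧ wd c (alt i j m) = wd c (alt j i m) ∧ wd M (alt i j m) = wd M (alt j i m) ∧
  (∀ k < m, ∃ x y : ℤ, 0 ≤ x ∧ 0 ≤ y ∧
    wd c (alt j i k).reverse (bas i) = x • bas i + y • bas j) ∧
  (∀ k < m, ∃ x y : ℤ, 0 ≤ x ∧ 0 ≤ y ∧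
    wd c (alt i j k).reverse (bas j) = x • bas j + y • bas i)

lemma BraidOK.symm {c : I → I → ℤ} {M : I → I → R} {i j : I} {m : ℕ}
    (h : BraidOK c M i j m) : BraidOK c M j i m :=
  ⟨h.1, h.2.1.symm, h.2.2.1.symm, h.2.2.2.2, h.2.2.2.1⟩

lemma exists_red (c : I → I → ℤ) (L : List I) : ∃ L', wd c L' = wd c L ∧ Red c L' := by
  classical
  have hex : ∃ n, ∃ L', wd c L' = wd c L ∧ L'.length = n := ⟨_, L, rfl, rfl⟩
  obtain ⟨L', h1, h2⟩ := Nat.find_spec hex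
  refine ⟨L', h1, fun L'' h => ?_⟩
  rw [h2]
  exact Nat.find_min' hex ⟨L'', h.trans h1, rfl⟩

lemma rf_sq (c : I → I → ℤ) (hc : ∀ i, c i i = 2) (i : I) : rf c i * rf c i = 1 := by
  refine LinearMap.ext fun v => ?_
  simp only [Module.End.mul_apply, Module.End.one_apply, rf_apply, map_sub, map_smul, frm_bas, hc]
  funext l
  simp
  ring

lemma rf_sq_apply (c : I → I → ℤ) (hc : ∀ i, c i i = 2) (i : I) (v : I → ℤ) :
    rf c i (rf c i v) = v := by
  have := congrArg (fun f => f v) (rf_sq c hc i)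
  simpa using this

lemma rf_self (c : I → I → ℤ) (hc : ∀ i, c i i = 2) (i : I) :
    rf c i (bas i) = - bas i := by
  rw [rf_bas, hc]
  funext l
  simp
  ring

lemma rf_cancel (c : I → I → ℤ) (hc : ∀ i, c i i = 2) (i : I) (A B : Module.End ℤ (I → ℤ))
    (h : rf c i * A = B) : A = rf c i * B := by
  rw [← h, ← mul_assoc, rf_sq c hc, one_mul]

lemma wd_rev_mul (c : I → I → ℤ) (hc : ∀ i, c i i = 2) (L : List I) :
    wd c L.reverse * wd c L = 1 := by
  induction L with
  | nil => simp
  | cons i L ih =>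
    simp only [List.reverse_cons, wd_append, wd_cons, wd_nil, mul_one]
    rw [mul_assoc, ← mul_assoc (rf c i), rf_sq c hc, one_mul, ih]

lemma wd_mul_rev (c : I → I → ℤ) (hc : ∀ i, c i i = 2) (L : List I) :
    wd c L * wd c L.reverse = 1 := by
  have := wd_rev_mul c hc L.reverse
  simpa using this

lemma wd_rev_congr (c : I → I → ℤ) (hc : ∀ i, c i i = 2) (L L' : List I)
    (h : wd c L = wd c L') : wd c L.reverse = wd c L'.reverse := by
  calc wd c L.reverse = wd c L.reverse * (wd c L' * wd c L'.reverse) := by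
        rw [wd_mul_rev c hc, mul_one]
    _ = wd c L'.reverse := by rw [← h, ← mul_assoc, wd_rev_mul c hc, one_mul]

lemma wd_rev_apply (c : I → I → ℤ) (hc : ∀ i, c i i = 2) (L : List I) (v : I → ℤ) :
    wd c L.reverse (wd c L v) = v := by
  have := congrArg (fun f => f v) (wd_rev_mul c hc L)
  simpa using this

lemma wd_apply_rev (c : I → I → ℤ) (hc : ∀ i, c i i = 2) (L : List I) (v : I → ℤ) :
    wd c L (wd c L.reverse v) = v := by
  have := congrArg (fun f => f v) (wd_mul_rev c hc L)
  simpa using this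

lemma Red.suffix {c : I → I → ℤ} {A V : List I} (h : Red c (A ++ V)) : Red c V := by
  intro L' hL'
  have := h (A ++ L') (by simp [hL'])
  simpa using this

lemma Red.prefix {c : I → I → ℤ} {A V : List I} (h : Red c (A ++ V)) : Red c A := by
  intro L' hL'
  have := h (L' ++ V) (by simp [hL'])
  simpa using this

lemma Red.tail {c : I → I → ℤ} {i : I} {V : List I} (h : Red c (i :: V)) : Red c V :=
  Red.suffix (A := [i]) h

/-- For a reduced word `i :: L`, no descent of `L` at `i`. -/
lemma Red.noDesc {c : I → I → ℤ} {i : I} {V : List I} (h : Red c (i :: V)) : NoDesc c i V := by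
  intro L' hL'
  have := h L' hL'
  simp at this
  omega

lemma red_of_eq {c : I → I → ℤ} {L L' : List I} (h : Red c L) (h1 : wd c L' = wd c L)
    (h2 : L'.length ≤ L.length) : Red c L' := by
  intro L'' h''
  exact h2.trans (h _ (h''.trans h1))

lemma pd (c : I → I → ℤ) (hc : ∀ i, c i i = 2) (i j : I) : ∀ (n : ℕ) (A V : List I),
    V.length = n → Red c (A ++ V) → (∀ x ∈ A, x = i ∨ x = j) →
    ∃ A' V', wd c (A' ++ V') = wd c (A ++ V) ∧ A'.length + V'.length = A.length + V.length ∧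
      (∀ x ∈ A', x = i ∨ x = j) ∧ V'.length ≤ V.length ∧ NoDesc c i V' ∧ NoDesc c j V' := by
  intro n
  induction n using Nat.strong_induction_on with
  | _ n ih =>
    intro A V hn hred hA
    have step : ∀ x, (x = i ∨ x = j) → ¬ NoDesc c x V →
        ∃ A' V', wd c (A' ++ V') = wd c (A ++ V) ∧ A'.length + V'.length = A.length + V.length ∧
        (∀ x ∈ A', x = i ∨ x = j) ∧ V'.length ≤ V.length ∧ NoDesc c i V' ∧ NoDesc c j V' := by
      intro x hx hnd
      simp only [NoDesc, not_forall, not_le] at hnd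
      obtain ⟨L', h1, h2⟩ := hnd
      have hw : wd c ((A ++ [x]) ++ L') = wd c (A ++ V) := by
        simp only [wd_append, wd_cons, wd_nil, mul_one, h1]
        rw [mul_assoc, ← mul_assoc (rf c x), rf_sq c hc, one_mul]
      have hlen : ((A ++ [x]) ++ L').length ≤ (A ++ V).length := by
        simp
        omega
      have hr := red_of_eq hred hw hlen
      obtain ⟨A', V', g1, g2, g3, g4, g5, g6⟩ := ih L'.length (by omega) (A ++ [x]) L' rfl hr (by
        intro y hy
        simp at hy
        rcases hy with hy | hy
        · exact hA y hy
        · rw [hy]; exact hx)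
      have := hred _ hw
      refine ⟨A', V', g1.trans hw, ?_, g3, by omega, g5, g6⟩
      simp at this hlen g2
      omega
    by_cases hi : NoDesc c i V
    · by_cases hj : NoDesc c j V
      · exact ⟨A, V, rfl, rfl, hA, le_rfl, hi, hj⟩
      · exact step j (Or.inr rfl) hj
    · exact step i (Or.inl rfl) hi

lemma red_alt (c : I → I → ℤ) (hc : ∀ i, c i i = 2) (i j : I) : ∀ A : List I,
    Red c A → (∀ x ∈ A, x = i ∨ x = j) → A = alt i j A.length ∨ A = alt j i A.length := by
  intro A
  induction A with
  | nil => intro _ _; left; rfl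
  | cons x A ih =>
    intro hr hA
    have hr' := hr.tail
    have hA' : ∀ x ∈ A, x = i ∨ x = j := fun y hy => hA y (by simp [hy])
    have key : ∀ y z, A = alt y z A.length → x = y → A = [] := by
      intro y z h1 h2
      by_contra hne
      cases A with
      | nil => exact hne rfl
      | cons a A =>
        simp [alt] at h1
        have : Red c (x :: x :: A) := by rw [h2]; rw [h1.1] at hr; rw [h2] at hr; exact hr
        have := this A (by
          simp only [wd_cons]
          rw [← mul_assoc, rf_sq c hc, one_mul])
        simp at this
    have hx := hA x (by simp)
    rcases ih hr' hA' with h | h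
    · rcases hx with hx | hx
      · have := key i j h hx
        left; subst this; simp [alt, hx]
      · right
        simp only [List.length_cons, alt]
        rw [← h, hx]
    · rcases hx with hx | hx
      · left
        simp only [List.length_cons, alt]
        rw [← h, hx]
      · have := key j i h hx
        right; subst this; simp [alt, hx]

lemma sign_lemma (c : I → I → ℤ) (M : I → I → R) (hc : ∀ i, c i i = 2)
    (hB : ∀ i j, i ≠ j → ∃ m, BraidOK c M i j m) :
    ∀ (n : ℕ) (L : List I), L.length = n → Red c L → ∀ i, NoDesc c i L →
      ∀ k, 0 ≤ wd c L.reverse (bas i) k := by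
  intro n
  induction n using Nat.strong_induction_on with
  | _ n ih =>
    intro L hn hr i hnd
    cases L with
    | nil =>
      intro k
      simp only [List.reverse_nil, wd_nil, Module.End.one_apply, bas, Pi.single_apply]
      split_ifs <;> norm_num
    | cons j L =>
      have hij : i ≠ j := by
        intro h
        have := hnd L (by
          rw [h]
          simp only [wd_cons]
          rw [← mul_assoc, rf_sq c hc, one_mul])
        simp at this
      obtain ⟨A, V, g1, g2, g3, g4, g5, g6⟩ := pd c hc i j L.length [j] L rfl hr (by simp)
      have g1' : wd c (A ++ V) = wd c (j :: L) := g1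
      have hrAV : Red c (A ++ V) := red_of_eq hr g1' (by simp at g2 ⊢; omega)
      obtain ⟨m, hm1, hm2, hm3, hm4, hm5⟩ := hB i j hij
      have hlen : A.length + V.length = (j :: L).length := by simp at g2 ⊢; omega
      have noi : ∀ S : List I, wd c (i :: S) = wd c A → S.length + 1 = A.length → False := by
        intro S hS hl
        have := hnd (S ++ V) (by
          rw [wd_cons, ← g1', wd_append, wd_append, ← hS, wd_cons, ← mul_assoc, ← mul_assoc,
            rf_sq c hc, one_mul])
        simp at this hlen
        omega
      have hAalt : ∃ k, k < m ∧ A = alt j i k := by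
        have hA : A = alt j i A.length := by
          rcases red_alt c hc i j A hrAV.prefix g3 with h | h
          · cases A with
            | nil => rfl
            | cons a A =>
              exfalso
              simp [alt] at h
              exact noi A (by rw [h.1]) (by simp)
          · exact h
        refine ⟨A.length, ?_, hA⟩
        by_contra hk
        push Not at hk
        obtain ⟨k, hk⟩ := Nat.exists_eq_add_of_le hk
        obtain ⟨S, hS1, hS2⟩ := alt_split j i m k
        rw [hk, hS1] at hA
        obtain ⟨m, rfl⟩ : ∃ m', m = m' + 1 := ⟨m - 1, by omega⟩
        refine noi (alt j i m ++ S) ?_ ?_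
        · rw [hA, wd_append, ← hm2]
          simp [alt, mul_assoc]
        · simp [alt_length, hk, hS2]; omega
      obtain ⟨k, hk, rfl⟩ := hAalt
      obtain ⟨x, y, hx, hy, hxy⟩ := hm4 k hk
      have hrV : Red c V := hrAV.suffix
      have i1 := ih V.length (by simp at g4 hn; omega) V rfl hrV i g5
      have i2 := ih V.length (by simp at g4 hn; omega) V rfl hrV j g6
      have e : wd c (j :: L).reverse (bas i) =
          x • wd c V.reverse (bas i) + y • wd c V.reverse (bas j) := by
        rw [← wd_rev_congr c hc _ _ g1', List.reverse_append, wd_append, Module.End.mul_apply, hxy,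
          map_add, map_smul, map_smul]
      intro l
      rw [e]
      have := mul_nonneg hx (i1 l)
      have := mul_nonneg hy (i2 l)
      simp
      linarith

lemma wd_rev_ne (c : I → I → ℤ) (hc : ∀ i, c i i = 2) (L : List I) (v : I → ℤ) (hv : v ≠ 0) :
    wd c L v ≠ 0 := by
  intro h
  apply hv
  rw [← wd_rev_apply c hc L v, h, map_zero]

lemma bas_ne_zero (i : I) : (bas i : I → ℤ) ≠ 0 := by
  intro h
  have := congrFun h i
  simp [bas] at this

lemma word_neg (c : I → I → ℤ) (M : I → I → R) (hc : ∀ i, c i i = 2)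
    (hB : ∀ i j, i ≠ j → ∃ m, BraidOK c M i j m) (i : I) (L : List I) (hr : Red c (i :: L)) :
    ∀ k, wd c (i :: L).reverse (bas i) k ≤ 0 := by
  intro k
  have := sign_lemma c M hc hB _ L rfl hr.tail i hr.noDesc k
  simp only [List.reverse_cons, wd_append, wd_cons, wd_nil, mul_one, Module.End.mul_apply,
    rf_self c hc, map_neg, Pi.neg_apply]
  linarith

/-- Sign coherence of roots. -/
lemma sign_coh (c : I → I → ℤ) (M : I → I → R) (hc : ∀ i, c i i = 2)
    (hB : ∀ i j, i ≠ j → ∃ m, BraidOK c M i j m) (i : I) (L : List I) :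
    (∀ k, 0 ≤ wd c L (bas i) k) ∨ (∀ k, wd c L (bas i) k ≤ 0) := by
  obtain ⟨L', h1, h2⟩ := exists_red c L.reverse
  have h1' : wd c L'.reverse = wd c L := by
    rw [wd_rev_congr c hc _ _ h1, List.reverse_reverse]
  rw [← h1']
  by_cases hnd : NoDesc c i L'
  · left
    exact sign_lemma c M hc hB _ L' rfl h2 i hnd
  · right
    simp only [NoDesc, not_forall, not_le] at hnd
    obtain ⟨L2, g1, g2⟩ := hnd
    have e : wd c (i :: L2) = wd c L' := by
      rw [wd_cons, g1, wd_cons, ← mul_assoc, rf_sq c hc, one_mul]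
    have hr : Red c (i :: L2) := red_of_eq h2 e (by simp; omega)
    rw [← wd_rev_congr c hc _ _ e]
    exact word_neg c M hc hB i L2 hr

/-- Matsumoto's theorem. -/
lemma matsumoto (c : I → I → ℤ) (M : I → I → R) (hc : ∀ i, c i i = 2)
    (hB : ∀ i j, i ≠ j → ∃ m, BraidOK c M i j m) :
    ∀ (n : ℕ) (L L' : List I), L.length = n → L'.length = n → Red c L → wd c L = wd c L' →
      wd M L = wd M L' := by
  intro n
  induction n with
  | zero =>
    intro L L' h1 h2 _ _
    rw [List.length_eq_zero_iff] at h1 h2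
    rw [h1, h2]
  | succ n ih =>
    intro L L' h1 h2 hr hw
    cases L with
    | nil => simp at h1
    | cons i L =>
    cases L' with
    | nil => simp at h2
    | cons j L' =>
    simp only [List.length_cons, add_left_inj] at h1 h2
    have hr' : Red c (j :: L') := red_of_eq hr hw.symm (by simp [h1, h2])
    by_cases hij : i = j
    · subst hij
      rw [wd_cons, wd_cons, ih L L' h1 h2 hr.tail]
      simp only [wd_cons] at hw
      have := rf_cancel c hc i _ _ hw
      rw [this, ← mul_assoc, rf_sq c hc, one_mul]
    · obtain ⟨m, hm1, hm2, hm3, hm4, hm5⟩ := hB i j hij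
      obtain ⟨A, V, g1, g2, g3, g4, g5, g6⟩ := pd c hc i j _ [] (i :: L) rfl (by simpa using hr)
        (by simp)
      simp only [List.nil_append, List.length_nil, zero_add, List.length_cons] at g1 g2
      have hrAV : Red c (A ++ V) := red_of_eq hr g1 (by simp; omega)
      have hVi := sign_lemma c M hc hB _ V rfl hrAV.suffix i g5
      have hVj := sign_lemma c M hc hB _ V rfl hrAV.suffix j g6
      have neg1 := word_neg c M hc hB i L hr
      have neg2 := word_neg c M hc hB j L' hr'
      rw [← wd_rev_congr c hc _ _ g1] at neg1
      rw [← wd_rev_congr c hc _ _ (g1.trans hw)] at neg2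
      have contra : ∀ a b a' : I, (∀ k, 0 ≤ wd c V.reverse (bas a) k) →
          (∀ k, 0 ≤ wd c V.reverse (bas b) k) →
          (∀ k, wd c (A ++ V).reverse (bas a') k ≤ 0) →
          (∃ x y : ℤ, 0 ≤ x ∧ 0 ≤ y ∧ wd c A.reverse (bas a') = x • bas a + y • bas b) →
          False := by
        rintro a b a' ha hb hn ⟨x, y, hx, hy, hxy⟩
        apply wd_rev_ne c hc (A ++ V).reverse (bas a') (bas_ne_zero a')
        funext k
        apply le_antisymm (hn k)
        rw [List.reverse_append, wd_append, Module.End.mul_apply, hxy, map_add,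
          map_smul, map_smul]
        have := mul_nonneg hx (ha k)
        have := mul_nonneg hy (hb k)
        simp
        linarith
      have hS : ∃ S : List I, wd c A = wd c (alt i j m ++ S) ∧ A.length = m + S.length := by
        rcases red_alt c hc i j A hrAV.prefix g3 with h | h
        · have hk : m ≤ A.length := by
            by_contra hk
            push Not at hk
            obtain ⟨x, y, hx, hy, hxy⟩ := hm5 _ hk
            rw [← h] at hxy
            exact contra j i j hVj hVi neg2 ⟨x, y, hx, hy, hxy⟩
          obtain ⟨k, hk⟩ := Nat.exists_eq_add_of_le hk
          obtain ⟨S, hS1, hS2⟩ := alt_split i j m k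
          refine ⟨S, ?_, by omega⟩
          conv_lhs => rw [h]
          rw [hk, hS1]
        · have hk : m ≤ A.length := by
            by_contra hk
            push Not at hk
            obtain ⟨x, y, hx, hy, hxy⟩ := hm4 _ hk
            rw [← h] at hxy
            exact contra i j i hVi hVj neg1 ⟨x, y, hx, hy, hxy⟩
          obtain ⟨k, hk⟩ := Nat.exists_eq_add_of_le hk
          obtain ⟨S, hS1, hS2⟩ := alt_split j i m k
          refine ⟨S, ?_, by omega⟩
          conv_lhs => rw [h]
          rw [hk, hS1, wd_append, wd_append, hm2]
      obtain ⟨S, hS1, hS2⟩ := hS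
      obtain ⟨m, rfl⟩ : ∃ m', m = m' + 1 := ⟨m - 1, by omega⟩
      have e1 : wd c (i :: (alt j i m ++ S ++ V)) = wd c (i :: L) := by
        rw [← g1, wd_append, hS1]
        simp [alt, mul_assoc]
      have e2 : wd c (j :: (alt i j m ++ S ++ V)) = wd c (j :: L') := by
        rw [← hw, ← g1, wd_append, hS1, wd_append, hm2]
        simp [alt, mul_assoc]
      have f1 : wd M L = wd M (alt j i m ++ S ++ V) := by
        refine ih _ _ h1 (by simp [alt_length]; omega) hr.tail ?_
        simp only [wd_cons] at e1
        have := rf_cancel c hc i _ _ e1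
        rw [this, ← mul_assoc, rf_sq c hc, one_mul]
      have f2 : wd M L' = wd M (alt i j m ++ S ++ V) := by
        refine ih _ _ h2 (by simp [alt_length]; omega) hr'.tail ?_
        simp only [wd_cons] at e2
        have := rf_cancel c hc j _ _ e2
        rw [this, ← mul_assoc, rf_sq c hc, one_mul]
      rw [wd_cons, wd_cons, f1, f2]
      simp only [alt, wd_cons] at hm3
      simp only [wd_append]
      rw [← mul_assoc, ← mul_assoc, ← mul_assoc, ← mul_assoc, hm3]

end Words

section RankTwo

variable [Fintype I] [DecidableEq I]

lemma pos_gen (c : I → I → ℤ) (hc : ∀ i, c i i = 2) (i j : I) (a b : ℤ) (m : ℕ)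
    (h1 : c i j = -a) (h2 : c j i = -b)
    (hm : (a = 0 ∧ b = 0 ∧ m = 2) ∨ (a = 1 ∧ b = 1 ∧ m = 3) ∨ (a = 2 ∧ b = 1 ∧ m = 4) ∨
      (a = 1 ∧ b = 2 ∧ m = 4) ∨ (a = 3 ∧ b = 1 ∧ m = 6) ∨ (a = 1 ∧ b = 3 ∧ m = 6)) :
    ∀ k < m, ∃ x y : ℤ, 0 ≤ x ∧ 0 ≤ y ∧
      wd c (alt j i k).reverse (bas i) = x • bas i + y • bas j := by
  have st1 : ∀ x y : ℤ, rf c j (x • bas i + y • bas j) = x • bas i + (b * x - y) • bas j := by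
    intro x y
    rw [map_add, map_smul, map_smul, rf_bas, rf_bas, h2, hc]
    module
  have st2 : ∀ x y : ℤ, rf c i (x • bas i + y • bas j) = (a * y - x) • bas i + y • bas j := by
    intro x y
    rw [map_add, map_smul, map_smul, rf_bas, rf_bas, h1, hc]
    module
  have st0 : (bas i : I → ℤ) = (1 : ℤ) • bas i + (0 : ℤ) • bas j := by module
  have key : ∀ k < 6, wd c (alt j i k).reverse (bas i) =
      ([1, 1, a * b - 1, a * b - 1, a * (b * (a * b - 1) - b) - (a * b - 1),
        a * (b * (a * b - 1) - b) - (a * b - 1)].getD k 0) • bas i +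
      ([0, b, b, b * (a * b - 1) - b, b * (a * b - 1) - b,
        b * (a * (b * (a * b - 1) - b) - (a * b - 1)) -
          (b * (a * b - 1) - b)].getD k 0) • bas j := by
    intro k hk
    interval_cases k
    all_goals
      simp only [alt, List.reverse_cons, List.reverse_nil, List.nil_append, List.cons_append,
        wd_cons, wd_nil, mul_one, Module.End.mul_apply, Module.End.one_apply]
      conv_lhs => rw [st0]
      try simp only [st1, st2]
      simp
  intro k hk
  rw [key k (by omega)]
  refine ⟨_, _, ?_, ?_, rfl⟩
  all_goals
    rcases hm with ⟨rfl, rfl, rfl⟩ | ⟨rfl, rfl, rfl⟩ | ⟨rfl, rfl, rfl⟩ | ⟨rfl, rfl, rfl⟩ |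
      ⟨rfl, rfl, rfl⟩ | ⟨rfl, rfl, rfl⟩
    all_goals
      interval_cases k <;> simp

lemma sZ_eq (c : I → I → ℤ) (i : I) : sZ c i = ⇑(rf c i) := by
  funext v k
  rw [rf_apply, frm_apply]
  simp [sZ, bas, Pi.single_apply]

lemma foldr_eq (c : I → I → ℤ) (L : List I) :
    (L.map (sZ c)).foldr (· ∘ ·) id = ⇑(wd c L) := by
  induction L with
  | nil => rfl
  | cons i L ih =>
    simp only [List.map_cons, List.foldr_cons, ih, wd_cons, sZ_eq]
    rfl

lemma memW_iff (c : I → I → ℤ) (w : (I → ℤ) → (I → ℤ)) : memW c w ↔ ∃ L, w = ⇑(wd c L) := by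
  simp only [memW, foldr_eq]

lemma prod_lt_four (c : I → I → ℤ) (hc : ∀ i, c i i = 2)
    (hoff : ∀ i j, i ≠ j → c i j ≤ 0)
    (hWfin : {w : (I → ℤ) → (I → ℤ) | memW c w}.Finite) (i j : I) (hij : i ≠ j) :
    c i j * c j i < 4 := by
  by_contra h4
  push Not at h4
  have hmem : ∀ k : ℕ, ∃ L, (rf c i * rf c j) ^ k = wd c L := by
    intro k
    induction k with
    | zero => exact ⟨[], by simp⟩
    | succ k ih =>
      obtain ⟨L, hL⟩ := ih
      exact ⟨i :: j :: L, by rw [pow_succ', hL, wd_cons, wd_cons, mul_assoc]⟩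
  have inv : ∀ k : ℕ, ∃ x y : ℤ, ((rf c i * rf c j) ^ k) (bas i) = x • bas i + y • bas j ∧
      (k : ℤ) < x ∧ 0 < 2 * x + c i j * y := by
    intro k
    induction k with
    | zero => exact ⟨1, 0, by simp, by norm_num, by norm_num⟩
    | succ k ih =>
      obtain ⟨x, y, h1, h2, h3⟩ := ih
      refine ⟨-x + c i j * y + c i j * c j i * x, -y - c j i * x, ?_, ?_, ?_⟩
      · rw [pow_succ', Module.End.mul_apply, h1, Module.End.mul_apply]
        simp only [map_add, map_smul, rf_bas, map_sub, hc]
        module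
      · push_cast
        nlinarith
      · nlinarith
  have hinj : Function.Injective (fun k : ℕ => (⟨⇑((rf c i * rf c j) ^ k), by
      obtain ⟨L, hL⟩ := hmem k
      rw [hL]
      exact (memW_iff c _).2 ⟨L, rfl⟩⟩ : {w : (I → ℤ) → (I → ℤ) | memW c w})) := by
    have mono : StrictMono (fun k : ℕ => ((rf c i * rf c j) ^ k) (bas i) i) := by
      apply strictMono_nat_of_lt_succ
      intro k
      have val : ∀ x y : ℤ, (x • (bas i : I → ℤ) + y • (bas j : I → ℤ) : I → ℤ) i = x := by
        intro x y
        simp [bas, Pi.single_apply, hij]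
      obtain ⟨x, y, h1, h2, h3⟩ := inv k
      have e2 : ((rf c i * rf c j) ^ (k + 1)) (bas i) =
          (-x + c i j * y + c i j * c j i * x) • bas i + (-y - c j i * x) • bas j := by
        rw [pow_succ', Module.End.mul_apply, h1, Module.End.mul_apply]
        simp only [map_add, map_smul, rf_bas, map_sub, hc]
        module
      rw [h1, e2, val, val]
      nlinarith
    intro k l hkl
    simp only [Subtype.mk.injEq] at hkl
    apply mono.injective
    simp only [hkl]
  have := hWfin.to_subtype
  exact not_injective_infinite_finite _ hinj

end RankTwo

section QT

lemma qv_ne : qv ≠ 0 := by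
  rw [qv, Ne, FaithfulSMul.algebraMap_eq_zero_iff]
  exact MvPolynomial.X_ne_zero 0

lemma tv_ne : tv ≠ 0 := by
  rw [tv, Ne, FaithfulSMul.algebraMap_eq_zero_iff]
  exact MvPolynomial.X_ne_zero 1

/-- `Reg a b`: the rational function `a` has denominator a monomial,
and takes the value `b` at `q = t = 1`. -/
def Reg (a : KK) (b : ℚ) : Prop :=
  ∃ (n : ℕ) (p : MvPolynomial (Fin 2) ℚ), a * (qv * tv) ^ n = algebraMap _ KK p ∧
    MvPolynomial.eval (fun _ => (1 : ℚ)) p = b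

lemma qt_alg : qv * tv = algebraMap (MvPolynomial (Fin 2) ℚ) KK (MvPolynomial.X 0 * MvPolynomial.X 1) := by
  rw [map_mul]; rfl

lemma Reg.mul {a a' : KK} {b b' : ℚ} (h : Reg a b) (h' : Reg a' b') : Reg (a * a') (b * b') := by
  obtain ⟨n, p, h1, h2⟩ := h
  obtain ⟨n', p', h1', h2'⟩ := h'
  refine ⟨n + n', p * p', ?_, by rw [map_mul, h2, h2']⟩
  rw [map_mul, ← h1, ← h1']
  ring

lemma Reg.add {a a' : KK} {b b' : ℚ} (h : Reg a b) (h' : Reg a' b') : Reg (a + a') (b + b') := by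
  obtain ⟨n, p, h1, h2⟩ := h
  obtain ⟨n', p', h1', h2'⟩ := h'
  refine ⟨n + n', p * (MvPolynomial.X 0 * MvPolynomial.X 1) ^ n' +
    p' * (MvPolynomial.X 0 * MvPolynomial.X 1) ^ n, ?_, by simp [h2, h2']⟩
  rw [map_add, map_mul, map_mul, ← h1, ← h1', map_pow, map_pow, ← qt_alg]
  ring

lemma Reg.one : Reg 1 1 := ⟨0, 1, by simp, by simp⟩

lemma Reg.zero : Reg 0 0 := ⟨0, 0, by simp, by simp⟩

lemma Reg.neg {a : KK} {b : ℚ} (h : Reg a b) : Reg (-a) (-b) := by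
  obtain ⟨n, p, h1, h2⟩ := h
  exact ⟨n, -p, by rw [map_neg, ← h1]; ring, by simp [h2]⟩

lemma Reg.sub {a a' : KK} {b b' : ℚ} (h : Reg a b) (h' : Reg a' b') : Reg (a - a') (b - b') := by
  rw [sub_eq_add_neg, sub_eq_add_neg]
  exact h.add h'.neg

lemma Reg.sum {ι : Type} (s : Finset ι) (f : ι → KK) (g : ι → ℚ) (h : ∀ i ∈ s, Reg (f i) (g i)) :
    Reg (∑ i ∈ s, f i) (∑ i ∈ s, g i) := by
  classical
  induction s using Finset.induction_on with
  | empty => simpa using Reg.zero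
  | insert a s ha ih =>
    rw [Finset.sum_insert ha, Finset.sum_insert ha]
    exact (h a (by simp)).add (ih fun i hi => h i (by simp [hi]))

lemma Reg.varq : Reg qv 1 := ⟨0, MvPolynomial.X 0, by simp [qv], by simp⟩

lemma Reg.vart : Reg tv 1 := ⟨0, MvPolynomial.X 1, by simp [tv], by simp⟩

lemma Reg.qinv : Reg qv⁻¹ 1 :=
  ⟨1, MvPolynomial.X 1, by
    rw [pow_one, ← mul_assoc, inv_mul_cancel₀ qv_ne, one_mul]; rfl, by simp⟩

lemma Reg.tinv : Reg tv⁻¹ 1 :=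
  ⟨1, MvPolynomial.X 0, by
    rw [pow_one, mul_comm, mul_assoc, mul_inv_cancel₀ tv_ne, mul_one]; rfl, by simp⟩

lemma Reg.pow {a : KK} (h : Reg a 1) (n : ℕ) : Reg (a ^ n) 1 := by
  induction n with
  | zero => simpa using Reg.one
  | succ n ih => rw [pow_succ]; simpa using ih.mul h

lemma Reg.zpow {a : KK} (h : Reg a 1) (h' : Reg a⁻¹ 1) (n : ℤ) : Reg (a ^ n) 1 := by
  cases n with
  | ofNat n => simpa using h.pow n
  | negSucc n =>
    rw [zpow_negSucc, ← inv_pow]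
    exact h'.pow _

lemma Reg.eq_zero {b : ℚ} (h : Reg 0 b) : b = 0 := by
  obtain ⟨n, p, h1, h2⟩ := h
  rw [zero_mul, eq_comm, FaithfulSMul.algebraMap_eq_zero_iff] at h1
  rw [← h2, h1, map_zero]

lemma Reg.ne_zero {a : KK} {b : ℚ} (h : Reg a b) (hb : b ≠ 0) : a ≠ 0 := by
  rintro rfl
  exact hb h.eq_zero

lemma q_sub_ne : qv - qv⁻¹ ≠ 0 := by
  intro h
  have h2 : qv * qv = 1 := by
    have := congrArg (fun z => z * qv) h
    simp only [sub_mul, zero_mul, inv_mul_cancel₀ qv_ne] at this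
    exact sub_eq_zero.1 this
  rw [qv, ← map_mul, ← map_one (algebraMap (MvPolynomial (Fin 2) ℚ) KK)] at h2
  have h3 := FaithfulSMul.algebraMap_injective _ _ h2
  have h4 := congrArg (MvPolynomial.eval (fun _ => (2 : ℚ))) h3
  norm_num at h4

lemma qint_neg (k : ℤ) : qint (-k) = - qint k := by
  rw [qint, qint, neg_neg, ← neg_div, neg_sub]

lemma qint_zero : qint 0 = 0 := by simp [qint]

lemma qint_succ (k : ℤ) : qint (k + 1) = qv * qint k + qv ^ (-k) := by
  have h := q_sub_ne
  have h' := qv_ne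
  rw [qint, qint, div_eq_iff h, add_mul, mul_assoc, div_mul_cancel₀ _ h]
  rw [zpow_add₀ h', neg_add, zpow_add₀ h']
  simp only [zpow_one, zpow_neg]
  ring

lemma qint_one : qint 1 = 1 := by
  have := qint_succ 0
  simpa [qint_zero] using this

lemma Reg.qnum_nat (k : ℕ) : Reg (qint k) k := by
  induction k with
  | zero => simpa [qint_zero] using Reg.zero
  | succ k ih =>
    push_cast
    rw [qint_succ]
    simpa using (Reg.varq.mul ih).add (Reg.varq.zpow Reg.qinv (-(k : ℤ)))

lemma Reg.qnum (k : ℤ) : Reg (qint k) k := by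
  obtain ⟨n, rfl | rfl⟩ := k.eq_nat_or_neg
  · simpa using Reg.qnum_nat n
  · rw [qint_neg]
    simpa using (Reg.qnum_nat n).neg

end QT

section Deformed

variable [Fintype I] [DecidableEq I]

/-- `q^{-d_i} t`. -/
def qi (d : I → ℤ) (i : I) : KK := qv ^ (-(d i)) * tv

/-- The matrix of the deformed reflections. -/
def Mt (c : I → I → ℤ) (d : I → ℤ) (i j : I) : KK := qi d i * Cqt c d i j

lemma Mt_diag (c : I → I → ℤ) (d : I → ℤ) (i : I) : Mt c d i i = 1 + qi d i ^ 2 := by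
  have h := qv_ne
  have h' := tv_ne
  simp only [Mt, Cqt, qi, if_true]
  rw [zpow_neg]
  have h2 : qv ^ d i ≠ 0 := zpow_ne_zero _ h
  field_simp

lemma Mt_off (c : I → I → ℤ) (d : I → ℤ) (i j : I) (h : i ≠ j) :
    Mt c d i j = qi d i * qint (c i j) := by
  simp [Mt, Cqt, h]

lemma qint_neg_one : qint (-1) = -1 := by rw [qint_neg, qint_one]

lemma qint_two : qint 2 = qv + qv⁻¹ := by
  have := qint_succ 1
  norm_num [qint_one] at this
  exact this

lemma qint_three : qint 3 = qv ^ 2 + 1 + (qv⁻¹) ^ 2 := by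
  have h := qv_ne
  have := qint_succ 2
  norm_num [qint_two] at this
  rw [this]
  field_simp
  try ring

lemma braidOK_le (c : I → I → ℤ) (d : I → ℤ) (r : ℤ)
    (hdiag : ∀ i, c i i = 2)
    (hoff : ∀ i j, i ≠ j → c i j ≤ 0)
    (hdpos : ∀ i, 0 < d i)
    (hsymm : ∀ i j, d i * c i j = d j * c j i)
    (honer : ∀ i, d i = 1 ∨ d i = r)
    (hbmax : ∀ i j, i ≠ j → c i j ≠ 0 → d i * c i j = -(max (d i) (d j)))
    (hWfin : {w : (I → ℤ) → (I → ℤ) | memW c w}.Finite) (i j : I) (hij : i ≠ j)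
    (hle : d i ≤ d j) : ∃ m, BraidOK c (Mt c d) i j m := by
  have hdi := hdpos i
  have hdj := hdpos j
  by_cases h0 : c i j = 0
  · have h0' : c j i = 0 := by
      have := hsymm i j
      rw [h0, mul_zero, eq_comm, mul_eq_zero] at this
      omega
    refine ⟨2, by norm_num, braid2 _ _ _ h0 h0', braid2 _ _ _ ?_ ?_,
      pos_gen c hdiag i j 0 0 2 (by simpa) (by simpa) (by simp),
      pos_gen c hdiag j i 0 0 2 (by simpa) (by simpa) (by simp)⟩
    · rw [Mt_off _ _ _ _ hij, h0, qint_zero, mul_zero]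
    · rw [Mt_off _ _ _ _ hij.symm, h0', qint_zero, mul_zero]
  · have e1 := hbmax i j hij h0
    rw [max_eq_right hle] at e1
    have e2 := (hsymm i j).symm.trans e1
    have hji : c j i = -1 := by
      have : d j * (c j i + 1) = 0 := by linarith
      rcases mul_eq_zero.1 this with h | h <;> omega
    rcases eq_or_lt_of_le hle with heq | hlt
    · have hij1 : c i j = -1 := by
        have : d i * (c i j + 1) = 0 := by rw [← heq] at e1; linarith
        rcases mul_eq_zero.1 this with h | h <;> omega
      refine ⟨3, by norm_num, braid3 c i j 1 (by simp [hdiag]) (by simp [hdiag])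
        (by rw [hij1, hji]; norm_num),
        braid3 _ _ _ (qi d i) (Mt_diag _ _ _) ?_ ?_,
        pos_gen c hdiag i j 1 1 3 hij1 hji (by simp),
        pos_gen c hdiag j i 1 1 3 hji hij1 (by simp)⟩
      · rw [Mt_diag, qi, qi, heq]
      · rw [Mt_off _ _ _ _ hij, Mt_off _ _ _ _ hij.symm, hij1, hji, qint_neg_one, qi, qi, heq]
        ring
    · have hd1 : d i = 1 := by
        rcases honer i with h | h
        · exact h
        · rcases honer j with h' | h' <;> omega
      have hcij : c i j = - d j := by rw [hd1] at e1; linarith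
      have h4 := prod_lt_four c hdiag hoff hWfin i j hij
      rw [hcij, hji] at h4
      have h23 : d j = 2 ∨ d j = 3 := by omega
      have hq := qv_ne
      rcases h23 with h | h
      · rw [h] at hcij
        refine ⟨4, by norm_num, braid4 c i j 1 1 (by simp [hdiag]) (by simp [hdiag])
          (by rw [hcij, hji]; norm_num),
          braid4 _ _ _ (qi d i) (qi d j) (Mt_diag _ _ _) (Mt_diag _ _ _) ?_,
          pos_gen c hdiag i j 2 1 4 hcij hji (by simp),
          pos_gen c hdiag j i 1 2 4 hji hcij (by simp)⟩
        rw [Mt_off _ _ _ _ hij, Mt_off _ _ _ _ hij.symm, hcij, hji, qint_neg_one, qi, qi, hd1, h,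
          qint_neg, qint_two]
        simp only [zpow_neg, zpow_ofNat]
        field_simp
      · rw [h] at hcij
        refine ⟨6, by norm_num, braid6 c i j 1 1 (by simp [hdiag]) (by simp [hdiag])
          (by rw [hcij, hji]; norm_num),
          braid6 _ _ _ (qi d i) (qi d j) (Mt_diag _ _ _) (Mt_diag _ _ _) ?_,
          pos_gen c hdiag i j 3 1 6 hcij hji (by simp),
          pos_gen c hdiag j i 1 3 6 hji hcij (by simp)⟩
        rw [Mt_off _ _ _ _ hij, Mt_off _ _ _ _ hij.symm, hcij, hji, qint_neg_one, qi, qi, hd1, h,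
          qint_neg, qint_three]
        simp only [zpow_neg, zpow_ofNat]
        field_simp

lemma braidOK_all (c : I → I → ℤ) (d : I → ℤ) (r : ℤ)
    (hdiag : ∀ i, c i i = 2)
    (hoff : ∀ i j, i ≠ j → c i j ≤ 0)
    (hdpos : ∀ i, 0 < d i)
    (hsymm : ∀ i j, d i * c i j = d j * c j i)
    (honer : ∀ i, d i = 1 ∨ d i = r)
    (hbmax : ∀ i j, i ≠ j → c i j ≠ 0 → d i * c i j = -(max (d i) (d j)))
    (hWfin : {w : (I → ℤ) → (I → ℤ) | memW c w}.Finite) (i j : I) (hij : i ≠ j) :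
    ∃ m, BraidOK c (Mt c d) i j m := by
  rcases le_total (d i) (d j) with h | h
  · exact braidOK_le c d r hdiag hoff hdpos hsymm honer hbmax hWfin i j hij h
  · obtain ⟨m, hm⟩ := braidOK_le c d r hdiag hoff hdpos hsymm honer hbmax hWfin j i hij.symm h
    exact ⟨m, hm.symm⟩

lemma qi_ne (d : I → ℤ) (i : I) : qi d i ≠ 0 := mul_ne_zero (zpow_ne_zero _ qv_ne) tv_ne

lemma Reg_qi (d : I → ℤ) (i : I) : Reg (qi d i) 1 := by
  have := (Reg.varq.zpow Reg.qinv (-(d i))).mul Reg.vart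
  rwa [mul_one] at this

lemma Reg_Mt (c : I → I → ℤ) (hdiag : ∀ i, c i i = 2) (d : I → ℤ) (i j : I) :
    Reg (Mt c d i j) (c i j) := by
  by_cases h : i = j
  · subst h
    rw [Mt_diag, hdiag]
    have := Reg.one.add ((Reg_qi d i).pow 2)
    norm_num at this
    exact this
  · rw [Mt_off _ _ _ _ h]
    simpa using (Reg_qi d i).mul (Reg.qnum (c i j))

lemma Reg_rf (c : I → I → ℤ) (hdiag : ∀ i, c i i = 2) (d : I → ℤ) (i : I) (v : I → KK)
    (w : I → ℤ) (h : ∀ k, Reg (v k) (w k)) (k : I) :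
    Reg (rf (Mt c d) i v k) ((rf c i w k : ℤ) : ℚ) := by
  rw [rf_apply, rf_apply, frm_apply, frm_apply]
  simp only [Pi.sub_apply, Pi.smul_apply, smul_eq_mul]
  push_cast
  refine (h k).sub (Reg.mul (Reg.sum _ _ _ fun l _ => (Reg_Mt c hdiag d i l).mul (h l)) ?_)
  by_cases hk : k = i
  · subst hk
    simpa [bas] using Reg.one
  · simpa [bas, Pi.single_apply, hk] using Reg.zero

lemma Reg_wd (c : I → I → ℤ) (hdiag : ∀ i, c i i = 2) (d : I → ℤ) (L : List I) (j : I) (k : I) :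
    Reg (wd (Mt c d) L (bas j) k) ((wd c L (bas j) k : ℤ) : ℚ) := by
  induction L generalizing k with
  | nil =>
    by_cases hk : k = j
    · subst hk
      simpa [bas] using Reg.one
    · simpa [bas, Pi.single_apply, hk] using Reg.zero
  | cons i L ih =>
    rw [wd_cons, wd_cons, Module.End.mul_apply, Module.End.mul_apply]
    exact Reg_rf c hdiag d i _ _ ih k

lemma det_rf {R : Type} [CommRing R] (m : I → I → R) (i : I) :
    LinearMap.det (rf m i) = 1 - m i i := by
  have h : LinearMap.toMatrix' (rf m i) =
      1 + Matrix.replicateCol Unit (-(bas i) : I → R) * Matrix.replicateRow Unit (m i) := by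
    ext k l
    rw [LinearMap.toMatrix'_apply, rf_apply, frm_apply]
    simp [Matrix.mul_apply, Matrix.one_apply, bas, Pi.single_apply]
    ring
  rw [← LinearMap.det_toMatrix', h, Matrix.det_one_add_replicateCol_mul_replicateRow]
  simp [bas, sub_eq_add_neg]

lemma det_wd (c : I → I → ℤ) (d : I → ℤ) (L : List I) :
    LinearMap.det (wd (Mt c d) L) ^ 2 =
      qv ^ (-(4 * (L.map d).sum)) * tv ^ (4 * (L.length : ℤ)) := by
  have hq := qv_ne
  have ht := tv_ne
  induction L with
  | nil => simp
  | cons i L ih =>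
    rw [wd_cons, map_mul, mul_pow, ih, det_rf, Mt_diag, qi]
    simp only [List.map_cons, List.sum_cons, List.length_cons]
    push_cast
    rw [show -(4 * (d i + (L.map d).sum)) = -(d i) + -(d i) + -(d i) + -(d i) +
      -(4 * (L.map d).sum) by ring, show 4 * ((L.length : ℤ) + 1) = 4 * L.length + 4 by ring]
    simp only [zpow_add₀ hq, zpow_add₀ ht, zpow_ofNat]
    ring

/-- Roots of unity in `ℚ(q,t)`. -/
lemma KK_root_unity (z : KK) (n : ℕ) (hn : 0 < n) (h : z ^ (2 * n) = 1) : z = 1 ∨ z = -1 := by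
  have hint : IsIntegral (MvPolynomial (Fin 2) ℚ) z := by
    apply IsIntegral.of_pow (n := 2 * n) (by omega)
    rw [h]
    exact isIntegral_one
  obtain ⟨p, hp⟩ := IsIntegrallyClosed.isIntegral_iff.1 hint
  have hp2 : p ^ (2 * n) = 1 := by
    apply FaithfulSMul.algebraMap_injective (MvPolynomial (Fin 2) ℚ) KK
    rw [map_pow, hp, h, map_one]
  have hu : IsUnit p := IsUnit.of_pow_eq_one hp2 (by omega)
  obtain ⟨x, _, hx⟩ := MvPolynomial.isUnit_iff_eq_C_of_isReduced.1 hu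
  have hx2 : x ^ (2 * n) = 1 := by
    rw [hx, ← map_pow, ← map_one MvPolynomial.C] at hp2
    exact MvPolynomial.C_injective _ _ hp2
  have hx3 : x = 1 ∨ x = -1 := by
    rw [pow_mul] at hx2
    have h5 : x ^ 2 = 1 := (pow_eq_one_iff_of_nonneg (sq_nonneg x) (by omega)).1 hx2
    rcases mul_eq_zero.1 (show (x - 1) * (x + 1) = 0 by linarith) with h | h
    · left; linarith
    · right; linarith
  rw [← hp, hx]
  rcases hx3 with h | h <;> simp [h]

end Deformed

section Roots

variable [Fintype I] [DecidableEq I]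

/-- The hypotheses on the Cartan datum. -/
structure Dat (c : I → I → ℤ) (d : I → ℤ) (r : ℤ) : Prop where
  hdiag : ∀ i, c i i = 2
  hoff : ∀ i j, i ≠ j → c i j ≤ 0
  hdpos : ∀ i, 0 < d i
  hsymm : ∀ i j, d i * c i j = d j * c j i
  honer : ∀ i, d i = 1 ∨ d i = r
  hrmax : ∀ i, d i ≤ r
  hrmem : ∃ i, d i = r
  hbmax : ∀ i j, i ≠ j → c i j ≠ 0 → d i * c i j = -(max (d i) (d j))
  hconn : ∀ i j : I, Relation.ReflTransGen (fun a b => a ≠ b ∧ c a b ≠ 0) i j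
  hWfin : {w : (I → ℤ) → (I → ℤ) | memW c w}.Finite

lemma Dat.braid {c : I → I → ℤ} {d : I → ℤ} {r : ℤ} (D : Dat c d r) :
    ∀ i j, i ≠ j → ∃ m, BraidOK c (Mt c d) i j m :=
  braidOK_all c d r D.hdiag D.hoff D.hdpos D.hsymm D.honer D.hbmax D.hWfin

/-- Roots. -/
def IsRt (c : I → I → ℤ) (β : I → ℤ) : Prop := ∃ L i, β = wd c L (bas i)

lemma isRt_bas (c : I → I → ℤ) (i : I) : IsRt c (bas i) := ⟨[], i, by simp⟩

lemma IsRt.wd {c : I → I → ℤ} {β : I → ℤ} (h : IsRt c β) (L : List I) : IsRt c (wd c L β) := by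
  obtain ⟨L', i, rfl⟩ := h
  exact ⟨L ++ L', i, by simp⟩

lemma IsRt.rf {c : I → I → ℤ} {β : I → ℤ} (h : IsRt c β) (i : I) : IsRt c (rf c i β) := by
  simpa using h.wd [i]

lemma Dat.coh {c : I → I → ℤ} {d : I → ℤ} {r : ℤ} (D : Dat c d r) {β : I → ℤ} (h : IsRt c β) :
    (∀ k, 0 ≤ β k) ∨ (∀ k, β k ≤ 0) := by
  obtain ⟨L, i, rfl⟩ := h
  exact sign_coh c (Mt c d) D.hdiag D.braid i L

lemma IsRt.ne_zero {c : I → I → ℤ} {d : I → ℤ} {r : ℤ} (D : Dat c d r) {β : I → ℤ}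
    (h : IsRt c β) : β ≠ 0 := by
  obtain ⟨L, i, rfl⟩ := h
  exact wd_rev_ne c D.hdiag L _ (bas_ne_zero i)

lemma Dat.rt_fin {c : I → I → ℤ} {d : I → ℤ} {r : ℤ} (D : Dat c d r) :
    {β | IsRt c β}.Finite := by
  have h : {β | IsRt c β} ⊆
      ⋃ i : I, Set.image (fun w : (I → ℤ) → (I → ℤ) => w (bas i)) {w | memW c w} := by
    rintro β ⟨L, i, rfl⟩
    simp only [Set.mem_iUnion]
    exact ⟨i, _, (memW_iff c _).2 ⟨L, rfl⟩, rfl⟩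
  exact (Set.finite_iUnion fun i => D.hWfin.image _).subset h

/-- The invariant form. -/
def bf (c : I → I → ℤ) (d : I → ℤ) : (I → ℤ) →ₗ[ℤ] (I → ℤ) →ₗ[ℤ] ℤ :=
  Matrix.toLinearMap₂' ℤ (Matrix.of fun i j => d i * c i j)

lemma vec_eq (x : I → ℤ) : x = ∑ i, x i • bas i := by
  funext k
  simp [bas, Pi.single_apply]

lemma bf_expand (F : (I → ℤ) →ₗ[ℤ] (I → ℤ) →ₗ[ℤ] ℤ) (x y : I → ℤ) :
    F x y = ∑ i, x i * F (bas i) y := by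
  conv_lhs => rw [vec_eq x]
  simp only [map_sum, LinearMap.sum_apply, map_smul, LinearMap.smul_apply, smul_eq_mul]

lemma bf_bas (c : I → I → ℤ) (d : I → ℤ) (i : I) (y : I → ℤ) :
    bf c d (bas i) y = d i * frm c i y := by
  rw [bf, Matrix.toLinearMap₂'_apply, frm_apply, Finset.mul_sum]
  rw [Finset.sum_eq_single i]
  · simp only [bas, Pi.single_eq_same, Matrix.of_apply, smul_eq_mul]
    exact Finset.sum_congr rfl fun j _ => by ring
  · intro j _ hj
    simp [bas, Pi.single_apply, hj]
  · simp

lemma Dat.bf_symm {c : I → I → ℤ} {d : I → ℤ} {r : ℤ} (D : Dat c d r) (x y : I → ℤ) :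
    bf c d x y = bf c d y x := by
  rw [bf, Matrix.toLinearMap₂'_apply, Matrix.toLinearMap₂'_apply, Finset.sum_comm]
  refine Finset.sum_congr rfl fun i _ => Finset.sum_congr rfl fun j _ => ?_
  simp only [Matrix.of_apply, smul_eq_mul, D.hsymm i j]
  ring

lemma Dat.bf_rf {c : I → I → ℤ} {d : I → ℤ} {r : ℤ} (D : Dat c d r) (i : I) (x y : I → ℤ) :
    bf c d (rf c i x) (rf c i y) = bf c d x y := by
  simp only [rf_apply, map_sub, LinearMap.sub_apply, map_smul, LinearMap.smul_apply, bf_bas,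
    frm_bas, D.hdiag, smul_eq_mul]
  rw [D.bf_symm x (bas i), bf_bas]
  ring

lemma Dat.bf_wd {c : I → I → ℤ} {d : I → ℤ} {r : ℤ} (D : Dat c d r) (L : List I) (x y : I → ℤ) :
    bf c d (wd c L x) (wd c L y) = bf c d x y := by
  induction L with
  | nil => simp
  | cons i L ih => rw [wd_cons, Module.End.mul_apply, Module.End.mul_apply, D.bf_rf, ih]

lemma bf_self (c : I → I → ℤ) (d : I → ℤ) (hdiag : ∀ i, c i i = 2) (i : I) :
    bf c d (bas i) (bas i) = 2 * d i := by
  rw [bf_bas, frm_bas, hdiag]; ring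

lemma const_of_conn {c : I → I → ℤ} {d : I → ℤ} {r : ℤ} (D : Dat c d r) {X : Type} (κ : I → X)
    (h : ∀ i j, i ≠ j → c i j ≠ 0 → κ i = κ j) (i j : I) : κ i = κ j := by
  have := D.hconn i j
  induction this with
  | refl => rfl
  | tail _ h2 ih => exact ih.trans (h _ _ h2.1 h2.2)

lemma Dat.schur [Nonempty I] {c : I → I → ℤ} {d : I → ℤ} {r : ℤ} (D : Dat c d r)
    (F : (I → ℤ) →ₗ[ℤ] (I → ℤ) →ₗ[ℤ] ℤ) (hs : ∀ x y, F x y = F y x)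
    (hi : ∀ i x y, F (rf c i x) (rf c i y) = F x y) :
    ∀ (i : I) (x y : I → ℤ), F x y * (2 * d i) = F (bas i) (bas i) * bf c d x y := by
  have h1 : ∀ i y, 2 * F (bas i) y = F (bas i) (bas i) * frm c i y := by
    intro i y
    have := hi i (bas i) y
    rw [rf_self c D.hdiag, rf_apply] at this
    simp only [map_neg, LinearMap.neg_apply, map_sub, map_smul, smul_eq_mul] at this
    linarith
  let κ : I → ℚ := fun i => (F (bas i) (bas i) : ℚ) / d i
  have hd : ∀ i, (d i : ℚ) ≠ 0 := fun i => by exact_mod_cast (D.hdpos i).ne'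
  have hκ : ∀ i j, κ i = κ j := by
    apply const_of_conn D
    intro i j hij hc
    have a1 := h1 i (bas j)
    have a2 := h1 j (bas i)
    rw [hs (bas j) (bas i), a1, frm_bas, frm_bas] at a2
    have a3 := D.hsymm i j
    simp only [κ]
    rw [div_eq_div_iff (hd i) (hd j)]
    have a4 : F (bas i) (bas i) * d j = F (bas j) (bas j) * d i := by
      have : (F (bas i) (bas i) * d j - F (bas j) (bas j) * d i) * c i j = 0 := by
        rw [sub_mul]
        linear_combination d j * a2 - F (bas j) (bas j) * a3
      rcases mul_eq_zero.1 this with h | h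
      · linarith
      · exact absurd h hc
    exact_mod_cast a4
  intro i x y
  have hk : ∀ j, F (bas j) (bas j) * d i = F (bas i) (bas i) * d j := by
    intro j
    have := hκ j i
    simp only [κ] at this
    rw [div_eq_div_iff (hd j) (hd i)] at this
    exact_mod_cast this
  rw [bf_expand F x y, bf_expand (bf c d) x y, Finset.sum_mul, Finset.mul_sum]
  refine Finset.sum_congr rfl fun j _ => ?_
  rw [bf_bas]
  linear_combination x j * d i * h1 j y + x j * frm c j y * hk j

lemma Dat.pos_def [Nonempty I] {c : I → I → ℤ} {d : I → ℤ} {r : ℤ} (D : Dat c d r)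
    (x : I → ℤ) (hx : x ≠ 0) : 0 < bf c d x x := by
  classical
  have hfin : {f : Module.End ℤ (I → ℤ) | ∃ L, f = wd c L}.Finite := by
    apply Set.Finite.of_finite_image (f := fun f : Module.End ℤ (I → ℤ) => (⇑f))
    · apply D.hWfin.subset
      rintro _ ⟨f, ⟨L, rfl⟩, rfl⟩
      exact (memW_iff c _).2 ⟨L, rfl⟩
    · intro f _ g _ h
      exact DFunLike.coe_injective h
  set S := hfin.toFinset with hS
  have hmem : ∀ f, f ∈ S ↔ ∃ L, f = wd c L := fun f => by simp [hS]
  let dot : (I → ℤ) →ₗ[ℤ] (I → ℤ) →ₗ[ℤ] ℤ := Matrix.toLinearMap₂' ℤ (1 : Matrix I I ℤ)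
  have hdot : ∀ x y, dot x y = ∑ k, x k * y k := by
    intro x y
    simp only [dot, Matrix.toLinearMap₂'_apply, Matrix.one_apply]
    simp
  let F : (I → ℤ) →ₗ[ℤ] (I → ℤ) →ₗ[ℤ] ℤ := ∑ f ∈ S, dot.compl₁₂ f f
  have hF : ∀ x y, F x y = ∑ f ∈ S, ∑ k, f x k * f y k := by
    intro x y
    simp [F, LinearMap.sum_apply, LinearMap.compl₁₂_apply, hdot]
  have hFs : ∀ x y, F x y = F y x := by
    intro x y
    rw [hF, hF]
    exact Finset.sum_congr rfl fun f _ => Finset.sum_congr rfl fun k _ => mul_comm _ _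
  have hFi : ∀ i x y, F (rf c i x) (rf c i y) = F x y := by
    intro i x y
    rw [hF, hF]
    refine Finset.sum_nbij' (fun f => f * rf c i) (fun f => f * rf c i) ?_ ?_ ?_ ?_ ?_
    · intro f hf
      obtain ⟨L, rfl⟩ := (hmem f).1 hf
      exact (hmem _).2 ⟨L ++ [i], by simp⟩
    · intro f hf
      obtain ⟨L, rfl⟩ := (hmem f).1 hf
      exact (hmem _).2 ⟨L ++ [i], by simp⟩
    · intro f _
      simp only [mul_assoc, rf_sq c D.hdiag, mul_one]
    · intro f _
      simp only [mul_assoc, rf_sq c D.hdiag, mul_one]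
    · intro f _
      rfl
  have hpos : ∀ x, x ≠ 0 → 0 < F x x := by
    intro x hx
    rw [hF]
    refine Finset.sum_pos' (fun f _ => Finset.sum_nonneg fun k _ => mul_self_nonneg _)
      ⟨1, (hmem _).2 ⟨[], by simp⟩, ?_⟩
    obtain ⟨k, hk⟩ := Function.ne_iff.1 hx
    exact Finset.sum_pos' (fun k _ => mul_self_nonneg _)
      ⟨k, Finset.mem_univ _, mul_self_pos.2 hk⟩
  obtain ⟨i⟩ := ‹Nonempty I›
  have h := D.schur F hFs hFi i x x
  have h1 := hpos x hx
  have h2 := hpos (bas i) (bas_ne_zero i)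
  have h3 := D.hdpos i
  have h4 : 0 < F (bas i) (bas i) * bf c d x x := by rw [← h]; positivity
  exact (pos_iff_pos_of_mul_pos h4).1 h2

end Roots

section Counting

variable [Fintype I] [DecidableEq I]

lemma IsRt.neg {c : I → I → ℤ} {d : I → ℤ} {r : ℤ} (D : Dat c d r) {β : I → ℤ} (h : IsRt c β) :
    IsRt c (-β) := by
  obtain ⟨L, i, rfl⟩ := h
  refine ⟨L ++ [i], i, ?_⟩
  rw [wd_append, Module.End.mul_apply, wd_cons, wd_nil, mul_one, rf_self c D.hdiag, map_neg]

lemma rf_apply_ne (c : I → I → ℤ) (i k : I) (h : k ≠ i) (v : I → ℤ) : rf c i v k = v k := by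
  rw [rf_apply]
  simp [bas, Pi.single_apply, h]

/-- `P` is the set of positive roots. -/
def PosRts (c : I → I → ℤ) (P : Finset (I → ℤ)) : Prop :=
  ∀ β, β ∈ P ↔ IsRt c β ∧ ∀ k, 0 ≤ β k

lemma Dat.exists_posRts {c : I → I → ℤ} {d : I → ℤ} {r : ℤ} (D : Dat c d r) :
    ∃ P, PosRts c P := by
  have h : {β | IsRt c β ∧ ∀ k, 0 ≤ β k}.Finite := D.rt_fin.subset fun β h => h.1
  exact ⟨h.toFinset, fun β => by simp⟩

lemma bas_nonneg (i k : I) : 0 ≤ (bas i : I → ℤ) k := by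
  simp only [bas, Pi.single_apply]; split_ifs <;> simp

lemma PosRts.bas_mem {c : I → I → ℤ} {P : Finset (I → ℤ)} (hP : PosRts c P) (i : I) :
    bas i ∈ P := (hP _).2 ⟨isRt_bas c i, bas_nonneg i⟩

lemma PosRts.rf_mem {c : I → I → ℤ} {d : I → ℤ} {r : ℤ} (D : Dat c d r) {P : Finset (I → ℤ)}
    (hP : PosRts c P) (i : I) {β : I → ℤ} (hβ : β ∈ P) (hne : β ≠ bas i) : rf c i β ∈ P := by
  obtain ⟨h1, h2⟩ := (hP β).1 hβ
  refine (hP _).2 ⟨h1.rf i, ?_⟩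
  by_cases hk : ∃ k, k ≠ i ∧ β k ≠ 0
  · obtain ⟨k, hki, hk0⟩ := hk
    rcases D.coh (h1.rf i) with h | h
    · exact h
    · exfalso
      have := h k
      rw [rf_apply_ne c i k hki] at this
      exact hk0 (le_antisymm this (h2 k))
  · push Not at hk
    exfalso
    have hb : β = β i • bas i := by
      funext k
      by_cases hki : k = i
      · subst hki; simp [bas]
      · simp [bas, hki, hk k hki]
    obtain ⟨L, j, hL⟩ := h1
    have h3 : bas j = β i • wd c L.reverse (bas i) := by
      rw [← map_smul, ← hb, hL, wd_rev_apply c D.hdiag]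
    have h4 := congrFun h3 j
    simp only [bas, Pi.single_eq_same, Pi.smul_apply, smul_eq_mul] at h4
    have h5 : β i = 1 := by
      rcases Int.isUnit_iff.1 (IsUnit.of_mul_eq_one _ h4.symm) with h | h
      · exact h
      · have := h2 i; omega
    rw [h5, one_smul] at hb
    exact hne hb

lemma PosRts.sum_rf {c : I → I → ℤ} {d : I → ℤ} {r : ℤ} (D : Dat c d r) {P : Finset (I → ℤ)}
    (hP : PosRts c P) (i : I) (g : (I → ℤ) → ℚ) :
    ∑ β ∈ P.erase (bas i), g (rf c i β) = ∑ β ∈ P.erase (bas i), g β := by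
  have key : ∀ β ∈ P.erase (bas i), rf c i β ∈ P.erase (bas i) := by
    intro β hβ
    obtain ⟨h1, h2⟩ := Finset.mem_erase.1 hβ
    refine Finset.mem_erase.2 ⟨fun h => ?_, hP.rf_mem D i h2 h1⟩
    have h3 := congrArg (rf c i) h
    rw [rf_sq_apply c D.hdiag, rf_self c D.hdiag] at h3
    have h4 := ((hP β).1 h2).2 i
    rw [h3] at h4
    simp [bas] at h4
  refine Finset.sum_nbij' (fun β => rf c i β) (fun β => rf c i β) key key ?_ ?_ ?_
  · intro β _; exact rf_sq_apply c D.hdiag i β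
  · intro β _; exact rf_sq_apply c D.hdiag i β
  · intro β _; rfl

lemma PosRts.sum_odd {c : I → I → ℤ} {d : I → ℤ} {r : ℤ} (D : Dat c d r) {P : Finset (I → ℤ)}
    (hP : PosRts c P) (i : I) (g : (I → ℤ) → ℚ) (hg : ∀ β, g (rf c i β) = - g β) :
    ∑ β ∈ P, g β = g (bas i) := by
  have h := hP.sum_rf D i g
  simp only [hg, Finset.sum_neg_distrib] at h
  rw [← Finset.add_sum_erase _ _ (hP.bas_mem i)]
  linarith

lemma Dat.bf_flip {c : I → I → ℤ} {d : I → ℤ} {r : ℤ} (D : Dat c d r) (i : I) (β : I → ℤ) :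
    bf c d (rf c i β) (bas i) = - bf c d β (bas i) := by
  rw [← D.bf_rf i, rf_sq_apply c D.hdiag, rf_self c D.hdiag, map_neg]

lemma bf_expand_right (F : (I → ℤ) →ₗ[ℤ] (I → ℤ) →ₗ[ℤ] ℤ) (x y : I → ℤ) :
    F x y = ∑ i, y i * F x (bas i) := by
  conv_lhs => rw [vec_eq y]
  simp only [map_sum, map_smul, smul_eq_mul]

lemma PosRts.casimir [Nonempty I] {c : I → I → ℤ} {d : I → ℤ} {r : ℤ} (D : Dat c d r)
    {P : Finset (I → ℤ)} (hP : PosRts c P) (f : (I → ℤ) → ℚ)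
    (hf : ∀ i β, f (rf c i β) = f β) :
    ∃ κ : ℚ, ∀ x k, ∑ β ∈ P, f β * bf c d β x * β k = κ * x k := by
  let κ : I → ℚ := fun i => ∑ β ∈ P, f β * bf c d β (bas i) * β i
  have h0 : ∀ i k, k ≠ i → ∑ β ∈ P, f β * bf c d β (bas i) * β k = 0 := by
    intro i k hk
    rw [hP.sum_odd D i (fun β => f β * bf c d β (bas i) * β k)]
    · simp [bas, hk]
    · intro β
      simp only [hf, D.bf_flip, rf_apply_ne c i k hk]
      push_cast
      ring
  have h1 : ∀ i k, ∑ β ∈ P, f β * bf c d β (bas i) * β k = κ i * (bas i : I → ℤ) k := by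
    intro i k
    by_cases hk : k = i
    · subst hk; simp [bas, κ]
    · rw [h0 i k hk]; simp [bas, hk]
  have h2 : ∀ i j, ∑ β ∈ P, f β * bf c d β (bas i) * bf c d β (bas j) = κ i * (d i * c i j) := by
    intro i j
    have : ∀ β ∈ P, f β * bf c d β (bas i) * bf c d β (bas j) =
        ∑ k, (f β * bf c d β (bas i) * β k) * bf c d (bas k) (bas j) := by
      intro β _
      conv_lhs => rw [bf_expand (bf c d) β (bas j)]
      push_cast
      rw [Finset.mul_sum]
      exact Finset.sum_congr rfl fun k _ => by ring
    rw [Finset.sum_congr rfl this, Finset.sum_comm]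
    simp only [← Finset.sum_mul, h1]
    rw [Finset.sum_eq_single i]
    · simp [bf_bas, frm_bas]; simp [bas]
    · intro k _ hk; simp [bas, hk]
    · simp
  have h3 : ∀ i j, κ i = κ j := by
    apply const_of_conn D
    intro i j hij hc
    have e : κ i * (d i * c i j) = κ j * (d j * c j i) := by
      rw [← h2, ← h2]
      exact Finset.sum_congr rfl fun β _ => by ring
    have e2 : (d i * c i j : ℚ) = d j * c j i := by exact_mod_cast D.hsymm i j
    rw [← e2] at e
    refine mul_right_cancel₀ ?_ e
    have := (D.hdpos i).ne'
    have : d i * c i j ≠ 0 := mul_ne_zero this hc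
    exact_mod_cast this
  obtain ⟨i0⟩ := ‹Nonempty I›
  refine ⟨κ i0, fun x k => ?_⟩
  have : ∀ β ∈ P, f β * bf c d β x * β k = ∑ i, x i * (f β * bf c d β (bas i) * β k) := by
    intro β _
    rw [bf_expand_right (bf c d) β x]
    push_cast
    rw [Finset.mul_sum, Finset.sum_mul]
    exact Finset.sum_congr rfl fun k _ => by ring
  rw [Finset.sum_congr rfl this, Finset.sum_comm]
  simp only [← Finset.mul_sum, h1]
  rw [Finset.sum_eq_single k]
  · rw [h3 k i0]; simp [bas]; ring
  · intro i _ hi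
    simp [bas, Ne.symm hi]
  · simp

lemma PosRts.kappa [Nonempty I] {c : I → I → ℤ} {d : I → ℤ} {r : ℤ} (D : Dat c d r)
    {P : Finset (I → ℤ)} (hP : PosRts c P) (f : (I → ℤ) → ℚ)
    (hf : ∀ i β, f (rf c i β) = f β) (θ : I → ℤ) (hθ : θ ∈ P)
    (hsq : ∀ β ∈ P, bf c d β θ * bf c d β θ = r * bf c d β θ + if β = θ then 2 * r * r else 0)
    (hθθ : bf c d θ θ = 2 * r) (hr : 0 < r) :
    (Fintype.card I : ℚ) * (∑ k, θ k * (d k * f (bas k)) + r * f θ) =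
      ∑ β ∈ P, f β * bf c d β β := by
  obtain ⟨κ, hκ⟩ := hP.casimir D f hf
  have h1 : ∑ β ∈ P, f β * bf c d β β = κ * Fintype.card I := by
    have : ∀ β ∈ P, f β * bf c d β β = ∑ k, f β * bf c d β (bas k) * β k := by
      intro β _
      conv_lhs => rw [bf_expand_right (bf c d) β β]
      push_cast
      rw [Finset.mul_sum]
      exact Finset.sum_congr rfl fun k _ => by ring
    rw [Finset.sum_congr rfl this, Finset.sum_comm]
    simp only [hκ]
    simp [bas, mul_comm]
  have h2 : ∑ β ∈ P, f β * bf c d β θ * bf c d β θ = κ * (2 * r) := by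
    have : ∀ β ∈ P, f β * bf c d β θ * bf c d β θ =
        ∑ k, (f β * bf c d β θ * β k) * bf c d (bas k) θ := by
      intro β _
      conv_lhs => enter [2]; rw [bf_expand (bf c d) β θ]
      push_cast
      rw [Finset.mul_sum]
      exact Finset.sum_congr rfl fun k _ => by ring
    rw [Finset.sum_congr rfl this, Finset.sum_comm]
    simp only [← Finset.sum_mul, hκ]
    have e : ((bf c d θ θ : ℤ) : ℚ) = 2 * r := by rw [hθθ]; push_cast; ring
    rw [← e, bf_expand (bf c d) θ θ]
    push_cast
    rw [Finset.mul_sum]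
    exact Finset.sum_congr rfl fun k _ => by ring
  have h3 : ∀ i, ∑ β ∈ P, f β * bf c d β (bas i) = f (bas i) * (2 * d i) := by
    intro i
    rw [hP.sum_odd D i (fun β => f β * bf c d β (bas i))]
    · rw [bf_self c d D.hdiag]; push_cast; ring
    · intro β
      simp only [hf, D.bf_flip]
      push_cast; ring
  have h4 : ∑ β ∈ P, f β * bf c d β θ = ∑ i, θ i * (f (bas i) * (2 * d i)) := by
    have : ∀ β ∈ P, f β * bf c d β θ = ∑ i, θ i * (f β * bf c d β (bas i)) := by
      intro β _
      rw [bf_expand_right (bf c d) β θ]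
      push_cast
      rw [Finset.mul_sum]
      exact Finset.sum_congr rfl fun k _ => by ring
    rw [Finset.sum_congr rfl this, Finset.sum_comm]
    simp only [← Finset.mul_sum, h3]
  have h5 : ∑ β ∈ P, f β * bf c d β θ * bf c d β θ =
      r * ∑ β ∈ P, f β * bf c d β θ + f θ * (2 * r * r) := by
    have : ∀ β ∈ P, f β * bf c d β θ * bf c d β θ =
        r * (f β * bf c d β θ) + if β = θ then f θ * (2 * r * r) else 0 := by
      intro β hβ
      have e : (bf c d β θ * bf c d β θ : ℚ) =
          r * bf c d β θ + if β = θ then 2 * r * r else 0 := by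
        exact_mod_cast hsq β hβ
      rw [mul_assoc, e]
      split_ifs with h
      · rw [h]; push_cast; ring
      · push_cast; ring
    rw [Finset.sum_congr rfl this, Finset.sum_add_distrib, ← Finset.mul_sum]
    simp [hθ]
  have hr' : (r : ℚ) ≠ 0 := by exact_mod_cast hr.ne'
  have h6 : κ = ∑ k, θ k * (d k * f (bas k)) + r * f θ := by
    have e : ∑ i, (θ i : ℚ) * (f (bas i) * (2 * d i)) = 2 * ∑ k, θ k * (d k * f (bas k)) := by
      rw [Finset.mul_sum]
      exact Finset.sum_congr rfl fun k _ => by ring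
    rw [h2, h4, e] at h5
    have : (2 * (r : ℚ)) ≠ 0 := mul_ne_zero two_ne_zero hr'
    apply mul_right_cancel₀ this
    rw [h5]; ring
  rw [h1, ← h6, mul_comm]

lemma PosRts.inv_sum {c : I → I → ℤ} {d : I → ℤ} {r : ℤ} (D : Dat c d r)
    {P : Finset (I → ℤ)} (hP : PosRts c P) (g : (I → ℤ) → ℚ)
    (hg : ∀ i β, g (rf c i β) = g β) : ∀ L : List I, Red c L →
    (∑ β ∈ P, if ∀ k, wd c L.reverse β k ≤ 0 then g β else 0) = (L.map fun i => g (bas i)).sum := by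
  intro L
  induction L with
  | nil =>
    intro _
    rw [List.map_nil, List.sum_nil]
    refine Finset.sum_eq_zero fun β hβ => ?_
    rw [if_neg]
    intro h
    obtain ⟨h1, h2⟩ := (hP β).1 hβ
    refine h1.ne_zero D (funext fun k => le_antisymm ?_ (h2 k))
    simpa using h k
  | cons i L ih =>
    intro hr
    have hs := sign_lemma c (Mt c d) D.hdiag D.braid _ L rfl hr.tail i hr.noDesc
    have ih := ih hr.tail
    let H : (I → ℤ) → ℚ := fun β => if ∀ k, wd c L.reverse β k ≤ 0 then g β else 0
    have e1 : (∑ β ∈ P, if ∀ k, wd c (i :: L).reverse β k ≤ 0 then g β else 0) =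
        ∑ β ∈ P, H (rf c i β) := by
      refine Finset.sum_congr rfl fun β _ => ?_
      simp only [H, hg, List.reverse_cons, wd_append, wd_cons, wd_nil, mul_one,
        Module.End.mul_apply]
    have hb : H (bas i) = 0 := by
      simp only [H]
      rw [if_neg]
      intro h
      exact wd_rev_ne c D.hdiag L.reverse _ (bas_ne_zero i)
        (funext fun k => le_antisymm (h k) (hs k))
    have hb2 : H (rf c i (bas i)) = g (bas i) := by
      simp only [H, hg]
      rw [if_pos]
      intro k
      rw [rf_self c D.hdiag, map_neg]
      simpa using hs k
    rw [e1, ← Finset.add_sum_erase _ _ (hP.bas_mem i), hb2, hP.sum_rf D i H,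
      List.map_cons, List.sum_cons, ← ih, ← Finset.add_sum_erase P H (hP.bas_mem i), hb, zero_add]

end Counting

section Theta

variable [Fintype I] [DecidableEq I]

lemma IsRt.norm {c : I → I → ℤ} {d : I → ℤ} {r : ℤ} (D : Dat c d r) {β : I → ℤ} (h : IsRt c β) :
    0 < bf c d β β ∧ bf c d β β ≤ 2 * r := by
  obtain ⟨L, i, rfl⟩ := h
  rw [D.bf_wd, bf_self c d D.hdiag]
  have := D.hdpos i
  have := D.hrmax i
  constructor <;> linarith

lemma Dat.theta_norm {c : I → I → ℤ} {d : I → ℤ} {r : ℤ} (D : Dat c d r) {θ : I → ℤ}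
    (hθ : IsRt c θ) (hhigh : ∀ β, IsRt c β → ∀ k, β k ≤ θ k)
    (hdom : ∀ i, 0 ≤ bf c d θ (bas i)) : bf c d θ θ = 2 * r := by
  have hfin : {β | IsRt c β ∧ bf c d β β = 2 * r}.Finite := D.rt_fin.subset fun β h => h.1
  obtain ⟨i0, hi0⟩ := D.hrmem
  obtain ⟨β, ⟨hβ1, hβ2⟩, hmax⟩ := Set.exists_max_image _ (fun β : I → ℤ => ∑ k, β k) hfin
    ⟨bas i0, isRt_bas c i0, by rw [bf_self c d D.hdiag, hi0]⟩
  have hβdom : ∀ i, 0 ≤ bf c d β (bas i) := by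
    intro i
    have h := hmax (rf c i β) ⟨hβ1.rf i, by rw [D.bf_rf, hβ2]⟩
    simp only [rf_apply, Pi.sub_apply, Finset.sum_sub_distrib, Pi.smul_apply, smul_eq_mul,
      ← Finset.mul_sum] at h
    have e : ∑ k, (bas i : I → ℤ) k = 1 := by simp [bas]
    rw [e] at h
    rw [D.bf_symm, bf_bas]
    exact mul_nonneg (D.hdpos i).le (by linarith)
  have hd : ∀ γ : I → ℤ, (∀ i, 0 ≤ bf c d γ (bas i)) → 0 ≤ bf c d γ (θ - β) := by
    intro γ hγ
    rw [bf_expand_right]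
    refine Finset.sum_nonneg fun k _ => mul_nonneg ?_ (hγ k)
    have := hhigh β hβ1 k
    simp only [Pi.sub_apply]; linarith
  have h1 := hd θ hdom
  have h2 := hd β hβdom
  rw [map_sub] at h1 h2
  have h3 := D.bf_symm θ β
  have h4 := (hθ.norm D).2
  linarith

lemma Dat.theta_dom {c : I → I → ℤ} {d : I → ℤ} {r : ℤ} (D : Dat c d r) {θ : I → ℤ}
    (hθ : IsRt c θ) (hhigh : ∀ β, IsRt c β → ∀ k, β k ≤ θ k) (i : I) :
    0 ≤ bf c d θ (bas i) := by
  have h := hhigh _ (hθ.rf i) i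
  rw [rf_apply] at h
  simp [bas] at h
  rw [D.bf_symm, bf_bas]
  exact mul_nonneg (D.hdpos i).le h

lemma Dat.theta_sq [Nonempty I] {c : I → I → ℤ} {d : I → ℤ} {r : ℤ} (D : Dat c d r) {θ : I → ℤ}
    (hθ : IsRt c θ) (hdom : ∀ i, 0 ≤ bf c d θ (bas i)) (hn : bf c d θ θ = 2 * r) (hr : 0 < r)
    {β : I → ℤ} (hβ : IsRt c β) (hpos : ∀ k, 0 ≤ β k) :
    bf c d β θ * bf c d β θ = r * bf c d β θ + if β = θ then 2 * r * r else 0 := by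
  split_ifs with h
  · subst h; rw [hn]; ring
  · have h0 : 0 ≤ bf c d β θ := by
      rw [bf_expand]
      refine Finset.sum_nonneg fun k _ => mul_nonneg (hpos k) ?_
      rw [D.bf_symm]; exact hdom k
    have h1 := D.pos_def (θ - β) (sub_ne_zero.2 (Ne.symm h))
    have h2 := (hβ.norm D).2
    have h3 := D.bf_symm θ β
    simp only [map_sub, LinearMap.sub_apply] at h1
    obtain ⟨L, i, rfl⟩ := hθ
    rw [D.bf_wd, bf_self c d D.hdiag] at hn
    have hm : bf c d β (wd c L (bas i)) = r * frm c i (wd c L.reverse β) := by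
      rw [← D.bf_wd L.reverse, wd_rev_apply c D.hdiag, D.bf_symm, bf_bas]
      congr 1
      linarith
    rw [D.bf_wd, bf_self c d D.hdiag, hn, h3] at h1
    rw [hm] at h0 h1 ⊢
    set m := frm c i (wd c L.reverse β)
    have a1 : 0 ≤ m := nonneg_of_mul_nonneg_right h0 hr
    have a2 : m < 2 := by
      by_contra hc
      push Not at hc
      nlinarith
    have : m = 0 ∨ m = 1 := by omega
    rcases this with e | e <;> rw [e] <;> ring

lemma Dat.counts [Nonempty I] {c : I → I → ℤ} {d : I → ℤ} {r : ℤ} (D : Dat c d r) {θ : I → ℤ}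
    (hθ : IsRt c θ) (hhigh : ∀ β, IsRt c β → ∀ k, β k ≤ θ k) (L : List I) (hL : Red c L)
    (hneg : ∀ i k, wd c L.reverse (bas i) k ≤ 0) :
    (Fintype.card I : ℤ) * (1 + ∑ k, θ k) = 2 * L.length ∧
    (Fintype.card I : ℤ) * (r + ∑ k, θ k * d k) = 2 * (L.map d).sum := by
  obtain ⟨P, hP⟩ := D.exists_posRts
  have hr : 0 < r := by
    obtain ⟨i, hi⟩ := D.hrmem
    rw [← hi]; exact D.hdpos i
  have hdom := D.theta_dom hθ hhigh
  have hn := D.theta_norm hθ hhigh hdom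
  have hθP : θ ∈ P := by
    refine (hP θ).2 ⟨hθ, fun k => ?_⟩
    exact (bas_nonneg k k).trans (hhigh _ (isRt_bas c k) k)
  have hsq : ∀ β ∈ P, bf c d β θ * bf c d β θ =
      r * bf c d β θ + if β = θ then 2 * r * r else 0 := fun β hβ =>
    D.theta_sq hθ hdom hn hr ((hP β).1 hβ).1 ((hP β).1 hβ).2
  have hall : ∀ β ∈ P, ∀ k, wd c L.reverse β k ≤ 0 := by
    intro β hβ k
    rw [vec_eq β, map_sum, Finset.sum_apply]
    refine Finset.sum_nonpos fun i _ => ?_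
    rw [map_smul, Pi.smul_apply, smul_eq_mul]
    exact mul_nonpos_of_nonneg_of_nonpos (((hP β).1 hβ).2 i) (hneg i k)
  have hsum : ∀ g : (I → ℤ) → ℚ, (∀ i β, g (rf c i β) = g β) →
      ∑ β ∈ P, g β = (L.map fun i => g (bas i)).sum := by
    intro g hg
    rw [← hP.inv_sum D g hg L hL]
    exact Finset.sum_congr rfl fun β hβ => by rw [if_pos (hall β hβ)]
  have hd : ∀ i, (d i : ℚ) ≠ 0 := fun i => by exact_mod_cast (D.hdpos i).ne'
  have hr' : (r : ℚ) ≠ 0 := by exact_mod_cast hr.ne'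
  constructor
  · have h1 := hP.kappa D (fun β => 2 / (bf c d β β : ℚ)) (fun i β => by simp only [D.bf_rf])
      θ hθP hsq hn hr
    have h2 : ∀ β ∈ P, 2 / (bf c d β β : ℚ) * bf c d β β = 2 := by
      intro β hβ
      have := (((hP β).1 hβ).1.norm D).1
      have : (bf c d β β : ℚ) ≠ 0 := by exact_mod_cast this.ne'
      field_simp
    rw [Finset.sum_congr rfl h2, hsum (fun _ => 2) (fun _ _ => rfl)] at h1
    have h3 : ∑ k, (θ k : ℚ) * (d k * (2 / (bf c d (bas k) (bas k) : ℚ))) = ∑ k, (θ k : ℚ) := by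
      refine Finset.sum_congr rfl fun k _ => ?_
      rw [bf_self c d D.hdiag]
      push_cast
      have := hd k
      field_simp
    have h4 : (r : ℚ) * (2 / (bf c d θ θ : ℚ)) = 1 := by
      rw [hn]; push_cast; field_simp
    simp only [h3, h4, List.map_const', List.sum_replicate, nsmul_eq_mul] at h1
    have : ((Fintype.card I : ℤ) * (1 + ∑ k, θ k) : ℚ) = 2 * L.length := by
      push_cast
      linarith
    exact_mod_cast this
  · have h1 := hP.kappa D (fun β => 1) (fun i β => rfl) θ hθP hsq hn hr
    simp only [one_mul, mul_one] at h1
    rw [hsum (fun β => (bf c d β β : ℚ)) (fun i β => by simp only [D.bf_rf])] at h1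
    have h2 : (L.map fun i => ((bf c d (bas i) (bas i) : ℤ) : ℚ)).sum = ((2 * (L.map d).sum : ℤ) : ℚ) := by
      clear h1 hall hsum hL hneg
      induction L with
      | nil => simp
      | cons i L ih =>
        rw [List.map_cons, List.sum_cons, ih, bf_self c d D.hdiag]
        simp
        ring
    rw [h2] at h1
    have h3 : (((Fintype.card I : ℤ) * (r + ∑ k, θ k * d k) : ℤ) : ℚ) = ((2 * (L.map d).sum : ℤ) : ℚ) := by
      rw [← h1]; push_cast; ring
    exact_mod_cast h3

end Theta

section Longest

variable [Fintype I] [DecidableEq I]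

lemma end_ext {R : Type} [CommRing R] {A B : Module.End R (I → R)}
    (h : ∀ j, A (bas j) = B (bas j)) : A = B := by
  apply LinearMap.pi_ext'
  intro j
  ext1
  exact h j

/-- Data of the longest element. -/
structure Lng (c : I → I → ℤ) (L : List I) (st : I → I) : Prop where
  red : Red c L
  act : ∀ i, wd c L (bas i) = - bas (st i)
  inv : Function.Involutive st

variable {c : I → I → ℤ} {d : I → ℤ} {r : ℤ} {L : List I} {st : I → I}

lemma Lng.dst (E : Lng c L st) (D : Dat c d r) (i : I) : d (st i) = d i := by
  have h := D.bf_wd L (bas i) (bas i)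
  rw [E.act, map_neg, map_neg, LinearMap.neg_apply, neg_neg, bf_self c d D.hdiag,
    bf_self c d D.hdiag] at h
  linarith

lemma Lng.cst (E : Lng c L st) (D : Dat c d r) (i j : I) : c (st i) (st j) = c i j := by
  have h := D.bf_wd L (bas i) (bas j)
  rw [E.act, E.act, map_neg, map_neg, LinearMap.neg_apply, neg_neg, bf_bas, bf_bas, frm_bas,
    frm_bas, E.dst D] at h
  exact mul_left_cancel₀ (D.hdpos i).ne' h

lemma Lng.Cst (E : Lng c L st) (D : Dat c d r) (i j : I) :
    Cqt c d (st i) (st j) = Cqt c d i j := by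
  simp only [Cqt, E.dst D, E.cst D, E.inv.injective.eq_iff]

lemma Lng.Mst (E : Lng c L st) (D : Dat c d r) (i j : I) :
    Mt c d (st i) (st j) = Mt c d i j := by
  simp only [Mt, qi, E.dst D, E.Cst D]

lemma Lng.sq (E : Lng c L st) : wd c L * wd c L = 1 := by
  apply end_ext
  intro j
  rw [Module.End.mul_apply, E.act, map_neg, E.act, neg_neg, E.inv]; rfl

lemma Lng.rev (E : Lng c L st) (D : Dat c d r) : wd c L.reverse = wd c L := by
  calc wd c L.reverse = wd c L.reverse * (wd c L * wd c L) := by rw [E.sq, mul_one]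
    _ = _ := by rw [← mul_assoc, wd_rev_mul c D.hdiag, one_mul]

lemma Lng.comm (E : Lng c L st) (D : Dat c d r) (i : I) :
    rf c i * wd c L = wd c L * rf c (st i) := by
  apply end_ext
  intro j
  rw [Module.End.mul_apply, Module.End.mul_apply, E.act, map_neg, rf_bas, rf_bas, map_sub,
    map_smul, E.act, E.act, E.inv, ← E.cst D (st i) j, E.inv]
  simp only [smul_neg]
  abel

lemma Lng.commT (E : Lng c L st) (D : Dat c d r) (i : I) :
    rf (Mt c d) i * wd (Mt c d) L = wd (Mt c d) L * rf (Mt c d) (st i) := by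
  obtain ⟨L1, h1, h2⟩ := exists_red c (i :: L)
  have hlt : L1.length < L.length := by
    by_contra hcon
    push Not at hcon
    have hnd : NoDesc c i L := fun L' hL' => hcon.trans (h2 L' (hL'.trans h1.symm))
    have := sign_lemma c (Mt c d) D.hdiag D.braid _ L rfl E.red i hnd (st i)
    rw [E.rev D, E.act] at this
    simp [bas] at this
  have e1 : wd c (i :: L1) = wd c L := by
    rw [wd_cons, h1, wd_cons, ← mul_assoc, rf_sq c D.hdiag, one_mul]
  have e2 : wd c (L1 ++ [st i]) = wd c L := by
    rw [wd_append, h1, wd_cons, wd_cons, wd_nil, mul_one, E.comm D, mul_assoc,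
      rf_sq c D.hdiag, mul_one]
  have l1 := E.red _ e1
  have l2 := E.red _ e2
  simp only [List.length_cons, List.length_append, List.length_nil] at l1 l2
  have m1 := matsumoto c (Mt c d) D.hdiag D.braid _ L (i :: L1) rfl
    (by simp only [List.length_cons]; omega) E.red e1.symm
  have m2 := matsumoto c (Mt c d) D.hdiag D.braid _ L (L1 ++ [st i]) rfl
    (by simp only [List.length_append, List.length_cons, List.length_nil]; omega) E.red e2.symm
  conv_lhs => rw [m2]
  rw [m1]
  simp [mul_assoc]

lemma Lng.exists_X (E : Lng c L st) (D : Dat c d r) [Nonempty I] :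
    ∃ X : KK, ∀ j, wd (Mt c d) L (bas j) = X • bas (st j) := by
  have hne : ∀ i, (1 + qi d i ^ 2) ≠ 0 := by
    intro i
    have := Reg.one.add ((Reg_qi d i).pow 2)
    exact this.ne_zero (by norm_num)
  have hq : ∀ i, qi d (st i) = qi d i := fun i => by simp only [qi, E.dst D]
  have h1 : ∀ i, ∃ X : KK, wd (Mt c d) L (bas (st i)) = X • bas i := by
    intro i
    have h := congrArg (fun A => A (bas (st i))) (E.commT D i)
    simp only [Module.End.mul_apply, rf_bas, Mt_diag, map_sub, map_smul, hq] at h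
    rw [rf_apply] at h
    set v := wd (Mt c d) L (bas (st i))
    refine ⟨(1 + qi d i ^ 2)⁻¹ * frm (Mt c d) i v, ?_⟩
    have h2 : (1 + qi d i ^ 2) • v = frm (Mt c d) i v • bas i := by
      have := sub_right_injective h
      exact this.symm
    rw [mul_smul, ← h2, smul_smul, inv_mul_cancel₀ (hne i), one_smul]
  choose X hX using h1
  have hXc : ∀ i j, X i = X j := by
    apply const_of_conn D
    intro i j hij hc
    have h := congrArg (fun A => A (bas (st j))) (E.commT D i)
    simp only [Module.End.mul_apply, rf_bas, map_sub, map_smul, hX, E.Mst D, smul_sub] at h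
    have h3 := congrFun (sub_right_injective h) i
    simp only [Pi.smul_apply, bas, Pi.single_eq_same, smul_eq_mul, mul_one] at h3
    have hM : Mt c d i j ≠ 0 := (Reg_Mt c D.hdiag d i j).ne_zero (by exact_mod_cast hc)
    rw [mul_comm] at h3
    exact (mul_left_cancel₀ hM h3).symm
  obtain ⟨i0⟩ := ‹Nonempty I›
  refine ⟨X i0, fun j => ?_⟩
  have := hX (st j)
  rw [E.inv] at this
  rw [this, hXc (st j) i0]

lemma Lng.main (E : Lng c L st) (D : Dat c d r) [Nonempty I] {θ : I → ℤ}
    (hθ : IsRt c θ) (hhigh : ∀ β, IsRt c β → ∀ k, β k ≤ θ k) (j : I) :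
    wd (Mt c d) L (bas j) =
      -(qv ^ (-(r + ∑ k, θ k * d k)) * tv ^ (1 + ∑ k, θ k)) • bas (st j) := by
  obtain ⟨X, hX⟩ := E.exists_X D
  have hneg : ∀ i k, wd c L.reverse (bas i) k ≤ 0 := by
    intro i k
    rw [E.rev D, E.act]
    simpa using bas_nonneg (st i) k
  obtain ⟨c1, c2⟩ := D.counts hθ hhigh L E.red hneg
  set N := r + ∑ k, θ k * d k
  set h := 1 + ∑ k, θ k
  set n := Fintype.card I with hn
  have hn0 : 0 < n := Fintype.card_pos
  set y := qv ^ (-N) * tv ^ h with hy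
  have hy0 : y ≠ 0 := mul_ne_zero (zpow_ne_zero _ qv_ne) (zpow_ne_zero _ tv_ne)
  have hTT : wd (Mt c d) L * wd (Mt c d) L = (X ^ 2) • (1 : Module.End KK (I → KK)) := by
    apply end_ext
    intro j
    rw [Module.End.mul_apply, hX, map_smul, hX, E.inv, smul_smul, pow_two]; rfl
  have hdet : X ^ (2 * n) = y ^ (2 * n) := by
    have e := det_wd c d L
    rw [pow_two, ← map_mul, hTT, LinearMap.det_smul, map_one, mul_one, Module.finrank_pi,
      ← pow_mul, ← hn] at e
    rw [e, hy, mul_pow, ← zpow_natCast, ← zpow_natCast, ← zpow_mul, ← zpow_mul]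
    congr 2
    · push_cast; linear_combination 2 * c2
    · push_cast; linear_combination -2 * c1
  have hz := KK_root_unity (X / y) n hn0 (by
    rw [div_pow, hdet, div_self (pow_ne_zero _ hy0)])
  have hRy : Reg y 1 := by
    have := (Reg.varq.zpow Reg.qinv (-N)).mul (Reg.vart.zpow Reg.tinv h)
    rwa [mul_one] at this
  have hRX : Reg X (-1) := by
    have := Reg_wd c D.hdiag d L j (st j)
    rw [hX, E.act] at this
    simpa [bas] using this
  rw [hX]
  congr 1
  rcases hz with hz | hz
  · exfalso
    rw [div_eq_iff hy0, one_mul] at hz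
    have := hRX.sub hRy
    rw [hz, sub_self] at this
    have := this.eq_zero
    norm_num at this
  · rw [div_eq_iff hy0] at hz
    rw [hz]; ring

end Longest

section Expansion

/-- `φ a` has only outer exponents `≤ m`. -/
def Bd (φ : KK →+* LL) (m : ℤ) (a : KK) : Prop := ∀ n, m < n → (φ a).coeff n = 0

lemma Bd.add {φ : KK →+* LL} {m : ℤ} {a b : KK} (ha : Bd φ m a) (hb : Bd φ m b) :
    Bd φ m (a + b) := by
  intro n hn
  rw [map_add, HahnSeries.coeff_add, ha n hn, hb n hn, add_zero]

lemma Bd.zero {φ : KK →+* LL} {m : ℤ} : Bd φ m 0 := by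
  intro n _
  rw [map_zero]; rfl

lemma Bd.neg {φ : KK →+* LL} {m : ℤ} {a : KK} (ha : Bd φ m a) : Bd φ m (-a) := by
  intro n hn
  rw [map_neg, HahnSeries.coeff_neg, ha n hn, neg_zero]

lemma Bd.mono {φ : KK →+* LL} {m m' : ℤ} {a : KK} (ha : Bd φ m a) (h : m ≤ m') : Bd φ m' a :=
  fun n hn => ha n (lt_of_le_of_lt h hn)

lemma Bd.mul {φ : KK →+* LL} {m m' : ℤ} {a b : KK} (ha : Bd φ m a) (hb : Bd φ m' b) :
    Bd φ (m + m') (a * b) := by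
  intro n hn
  rw [map_mul, HahnSeries.coeff_mul]
  refine Finset.sum_eq_zero fun x hx => ?_
  have h : x.1 + x.2 = n := by
    simp only [Finset.mem_antidiagonal, Finset.mem_addAntidiagonal] at hx
    exact hx.2.2
  by_cases h1 : m < x.1
  · rw [ha _ h1, zero_mul]
  · rw [hb x.2 (by omega), mul_zero]

lemma Bd.sum {φ : KK →+* LL} {m : ℤ} {ι : Type} (s : Finset ι) (f : ι → KK)
    (h : ∀ i ∈ s, Bd φ m (f i)) : Bd φ m (∑ i ∈ s, f i) := by
  classical
  induction s using Finset.induction_on with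
  | empty => simpa using Bd.zero
  | insert i s hi ih =>
    rw [Finset.sum_insert hi]
    exact (h i (Finset.mem_insert_self _ _)).add
      (ih fun j hj => h j (Finset.mem_insert_of_mem hj))

lemma Bd.ofC {φ : KK →+* LL} {a : KK} (z : FF) (h : φ a = HahnSeries.C z) : Bd φ 0 a := by
  intro n hn
  rw [h, HahnSeries.C_apply, HahnSeries.coeff_single_of_ne hn.ne']

lemma Bd.one {φ : KK →+* LL} : Bd φ 0 1 := Bd.ofC 1 (by rw [map_one, map_one])

/-- The variable `q` in `ℚ((q))`. -/
def qF : FF := HahnSeries.single (1 : ℤ) (1 : ℚ)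

lemma phi_qpow {φ : KK →+* LL} (hφq : φ qv = qL) (k : ℤ) :
    φ (qv ^ k) = HahnSeries.C (qF ^ k) := by
  rw [map_zpow₀, hφq, map_zpow₀]; rfl

lemma Bd.qnum {φ : KK →+* LL} (hφq : φ qv = qL) (k : ℤ) : Bd φ 0 (qint k) := by
  refine Bd.ofC ((qF ^ k - qF ^ (-k)) / (qF - qF⁻¹)) ?_
  rw [qint, map_div₀, map_div₀, map_sub, map_sub, map_sub, map_sub, phi_qpow hφq, phi_qpow hφq,
    map_inv₀, map_inv₀, hφq]
  rfl

lemma Bd.qi {φ : KK →+* LL} (hφq : φ qv = qL) (hφt : φ tv = tL) (d : I → ℤ) (i : I) :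
    Bd φ (-1) (qi d i) := by
  have h1 : Bd φ 0 (qv ^ (-(d i))) := Bd.ofC _ (phi_qpow hφq _)
  have h2 : Bd φ (-1) tv := by
    intro n hn
    rw [hφt, tL, HahnSeries.coeff_single_of_ne hn.ne']
  have := h1.mul h2
  rwa [zero_add] at this

lemma single_zpow' {F : Type} [Field F] (a n : ℤ) :
    (HahnSeries.single a (1 : F) : LaurentSeries F) ^ n = HahnSeries.single (n * a) (1 : F) := by
  have h : ∀ m : ℕ, (HahnSeries.single a (1 : F) : LaurentSeries F) ^ m =
      HahnSeries.single (m * a) (1 : F) := by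
    intro m
    rw [HahnSeries.single_pow, one_pow, nsmul_eq_mul]
  obtain ⟨m, rfl | rfl⟩ := n.eq_nat_or_neg
  · rw [zpow_natCast, h]
  · rw [zpow_neg, zpow_natCast, h, HahnSeries.inv_single, inv_one, neg_mul]

lemma dcoeff_shift {φ : KK →+* LL} (hφq : φ qv = qL) (hφt : φ tv = tL) (N h : ℤ) (a : KK)
    (u v : ℤ) :
    dcoeff (φ (qv ^ (-N) * tv ^ h * a)) u v = dcoeff (φ a) (u + N) (v - h) := by
  have e1 : φ (tv ^ h) = HahnSeries.single (-h) (1 : FF) := by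
    rw [map_zpow₀, hφt, tL, single_zpow', mul_neg_one]
  have e2 : φ (qv ^ (-N)) = HahnSeries.single 0 (HahnSeries.single (-N) (1 : ℚ)) := by
    rw [phi_qpow hφq, qF, single_zpow', mul_one]; rfl
  rw [map_mul, map_mul, e1, e2, dcoeff, dcoeff, HahnSeries.single_mul_single, zero_add, mul_one,
    HahnSeries.coeff_single_mul, HahnSeries.coeff_single_mul, one_mul]
  congr 2
  · ring
  · congr 1; ring

variable [Fintype I] [DecidableEq I]

lemma Bd.Mt {φ : KK →+* LL} (hφq : φ qv = qL) (hφt : φ tv = tL) (c : I → I → ℤ) (d : I → ℤ)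
    (i j : I) : Bd φ 0 (Mt c d i j) := by
  have hq := Bd.qi hφq hφt d i
  by_cases h : i = j
  · subst h
    rw [Mt_diag, pow_two]
    exact Bd.one.add ((hq.mul hq).mono (by norm_num))
  · rw [Mt_off c d i j h]
    exact (hq.mul (Bd.qnum hφq _)).mono (by norm_num)

lemma Bd.weight {φ : KK →+* LL} (hφq : φ qv = qL) (hφt : φ tv = tL) (c : I → I → ℤ) (d : I → ℤ)
    (p : I → KK) (hp : ∀ i, frm (_root_.Mt c d) i p = 0 ∨ frm (_root_.Mt c d) i p = _root_.qi d i)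
    (L : List I) : ∀ k, Bd φ (-1) (p k - wd (_root_.Mt c d) L p k) := by
  induction L with
  | nil => intro k; simpa using Bd.zero
  | cons i L ih =>
    intro k
    set x : I → KK := p - wd (_root_.Mt c d) L p with hx
    have e : wd (_root_.Mt c d) L p = p - x := by rw [hx]; abel
    have e2 : p k - wd (_root_.Mt c d) (i :: L) p k =
        frm (_root_.Mt c d) i p * bas i k + (x k + -(frm (_root_.Mt c d) i x * bas i k)) := by
      rw [wd_cons, Module.End.mul_apply, e, map_sub, rf_apply, rf_apply]
      simp only [Pi.sub_apply, Pi.smul_apply, smul_eq_mul]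
      ring
    have hb : Bd φ 0 ((bas i : I → KK) k) := by
      by_cases hk : k = i
      · subst hk; simpa [bas] using Bd.one
      · simpa [bas, hk] using Bd.zero
    have hf : Bd φ (-1) (frm (_root_.Mt c d) i p) := by
      rcases hp i with h | h <;> rw [h]
      · exact Bd.zero
      · exact Bd.qi hφq hφt d i
    have hfx : Bd φ (-1) (frm (_root_.Mt c d) i x) := by
      rw [frm_apply]
      refine Bd.sum _ _ fun l _ => ?_
      have := (Bd.Mt hφq hφt c d i l).mul (ih l)
      rwa [zero_add] at this
    rw [e2]
    have t1 := hf.mul hb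
    have t2 := hfx.mul hb
    rw [add_zero] at t1 t2
    exact t1.add ((ih k).add t2.neg)

lemma vec_eqK (x : I → KK) : x = ∑ i, x i • bas i := by
  funext k
  simp [bas, Pi.single_apply]

lemma Lng.final {c : I → I → ℤ} {d : I → ℤ} {r : ℤ} {L : List I} {st : I → I}
    (E : Lng c L st) (D : Dat c d r) [Nonempty I] {θ : I → ℤ}
    (hθ : IsRt c θ) (hhigh : ∀ β, IsRt c β → ∀ k, β k ≤ θ k)
    {φ : KK →+* LL} (hφq : φ qv = qL) (hφt : φ tv = tL) (i j : I) (u v : ℤ) (hv : v ≤ 0) :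
    dcoeff (φ ((Matrix.of (Cqt c d))⁻¹ i j)) u v =
        - dcoeff (φ ((Matrix.of (Cqt c d))⁻¹ i (st j)))
            (u + (r + ∑ k, θ k * d k)) (v - (1 + ∑ k, θ k)) := by
  by_cases hdet : IsUnit (Matrix.of (Cqt c d)).det
  swap
  · rw [Matrix.nonsing_inv_apply_not_isUnit _ hdet]
    simp [dcoeff]
  have hinv := Matrix.mul_nonsing_inv _ hdet
  set A := (Matrix.of (Cqt c d))⁻¹ with hA
  have hAst : ∀ i j, A (st i) j = A i (st j) := by
    intro i j
    have h1 : (Matrix.of (Cqt c d)).submatrix E.inv.toPerm E.inv.toPerm = Matrix.of (Cqt c d) := by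
      ext a b
      exact E.Cst D a b
    have h2 := Matrix.inv_submatrix_equiv (Matrix.of (Cqt c d)) E.inv.toPerm E.inv.toPerm
    rw [h1, ← hA] at h2
    have h3 := congrFun (congrFun h2 (st i)) j
    rw [h3, Matrix.submatrix_apply]
    exact congrArg₂ A (E.inv i) rfl
  let p : I → KK := fun k => A k j
  have hp : ∀ i, frm (Mt c d) i p = 0 ∨ frm (Mt c d) i p = qi d i := by
    intro i
    have h1 := congrFun (congrFun hinv i) j
    rw [Matrix.mul_apply] at h1
    have h2 : frm (Mt c d) i p = qi d i * (1 : Matrix I I KK) i j := by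
      rw [← h1, frm_apply, Finset.mul_sum]
      exact Finset.sum_congr rfl fun k _ => mul_assoc _ _ _
    rw [h2, Matrix.one_apply]
    split_ifs
    · right; rw [mul_one]
    · left; rw [mul_zero]
  have hb := Bd.weight hφq hφt c d p hp L i (-v) (by omega)
  have hT : wd (Mt c d) L p i =
      -(qv ^ (-(r + ∑ k, θ k * d k)) * tv ^ (1 + ∑ k, θ k) * A i (st j)) := by
    rw [vec_eqK p, map_sum, Finset.sum_apply, Finset.sum_eq_single (st i)]
    · rw [map_smul, E.main D hθ hhigh, E.inv]
      simp only [Pi.smul_apply, bas, Pi.single_eq_same, smul_eq_mul, p, hAst]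
      ring
    · intro l _ hl
      rw [map_smul, E.main D hθ hhigh]
      have : i ≠ st l := fun h => hl (by rw [h, E.inv])
      simp [bas, this]
    · simp
  rw [hT, sub_neg_eq_add, map_add, HahnSeries.coeff_add] at hb
  have h3 := dcoeff_shift hφq hφt (r + ∑ k, θ k * d k) (1 + ∑ k, θ k) (A i (st j)) u v
  rw [← h3, dcoeff, dcoeff]
  have h4 := congrArg (fun z : FF => z.coeff u) hb
  simp only [HahnSeries.coeff_add, HahnSeries.coeff_zero] at h4
  exact eq_neg_of_add_eq_zero_left h4

end Expansion

theorem statement_11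
    {I : Type} [Fintype I] [DecidableEq I] [Nonempty I]
    (c : I → I → ℤ) (d : I → ℤ) (r : ℤ)
    -- `C` is a symmetrizable generalized Cartan matrix
    (hdiag : ∀ i, c i i = 2)
    (hoff : ∀ i j, i ≠ j → c i j ≤ 0)
    -- `(d_i)` are positive integers with gcd 1 symmetrizing `C`
    (hdpos : ∀ i, 0 < d i)
    (hgcd : Finset.univ.gcd d = 1)
    (hsymm : ∀ i j, d i * c i j = d j * c j i)
    -- each `d_i ∈ {1, r}` where `r = max_i d_i`
    (honer : ∀ i, d i = 1 ∨ d i = r)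
    (hrmax : ∀ i, d i ≤ r)
    (hrmem : ∃ i, d i = r)
    -- `d_i c_{ij} = -max(d_i, d_j)` whenever `i ≠ j` and `c_{ij} ≠ 0`
    (hbmax : ∀ i j, i ≠ j → c i j ≠ 0 → d i * c i j = -(max (d i) (d j)))
    -- `C` is indecomposable
    (hconn : ∀ i j : I, Relation.ReflTransGen (fun a b => a ≠ b ∧ c a b ≠ 0) i j)
    -- `C` is of finite type: the Weyl group is finite
    (hWfin : {w : (I → ℤ) → (I → ℤ) | memW c w}.Finite)
    -- `θ = Σ a_i α_i` is the highest root: `θ ∈ Φ` and `θ - β ∈ Q₊` for all `β ∈ Φ`;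
    -- then `h = 1 + Σ a_i` and `N = r + Σ a_i d_i = r h^∨`
    (θ : I → ℤ)
    (hθΦ : ∃ w, memW c w ∧ ∃ i, θ = w (alphaZ i))
    (hθhigh : ∀ β : I → ℤ, (∃ w, memW c w ∧ ∃ i, β = w (alphaZ i)) → ∀ k, β k ≤ θ k)
    -- `w₀` is the longest element: `w₀ ∈ W` with `w₀(α_i) ∈ -Q₊` for all `i`,
    -- and `i ↦ i^*` is the involution with `w₀(α_i) = -α_{i^*}`
    (w0 : (I → ℤ) → (I → ℤ))
    (hw0W : memW c w0)
    (hw0neg : ∀ i k, w0 (alphaZ i) k ≤ 0)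
    (istar : I → I)
    (hstar : ∀ i, w0 (alphaZ i) = -alphaZ (istar i))
    (hstarinv : Function.Involutive istar)
    -- `φ` is the double Laurent expansion of `ℚ(q,t)`: first in `t⁻¹` (at `t = ∞`),
    -- then at `q = 0`; it is the unique ring homomorphism `ℚ(q,t) → ℚ((q))((t⁻¹))`
    -- sending `q`, `t` to their canonical images
    (φ : KK →+* LL)
    (hφq : φ qv = qL)
    (hφt : φ tv = tL)
    :
    ∀ (i j : I) (u v : ℤ), 0 ≤ u → v ≤ 0 →
      dcoeff (φ ((Matrix.of (Cqt c d))⁻¹ i j)) u v =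
        - dcoeff (φ ((Matrix.of (Cqt c d))⁻¹ i (istar j)))
            (u + (r + ∑ k, θ k * d k)) (v - (1 + ∑ k, θ k))
    := by
  have D : Dat c d r := ⟨hdiag, hoff, hdpos, hsymm, honer, hrmax, hrmem, hbmax, hconn, hWfin⟩
  have hθ : IsRt c θ := by
    obtain ⟨w, hw, i, e⟩ := hθΦ
    obtain ⟨L, rfl⟩ := (memW_iff c w).1 hw
    exact ⟨L, i, e⟩
  have hhigh : ∀ β, IsRt c β → ∀ k, β k ≤ θ k := by
    rintro β ⟨L, i, e⟩
    exact hθhigh β ⟨_, (memW_iff c _).2 ⟨L, rfl⟩, i, e⟩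
  obtain ⟨L', rfl⟩ := (memW_iff c w0).1 hw0W
  obtain ⟨L, hL, hred⟩ := exists_red c L'
  have E : Lng c L istar := ⟨hred, fun i => by rw [hL]; exact hstar i, hstarinv⟩
  intro i j u v _ hv
  exact E.final D hθ hhigh hφq hφt i j u v hv
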